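/- arXiv:2408.13475 — 8 statements merged into one kernel-verified Lean document; each statement's English description precedes it below -/
import Mathlib

section
/- Let n and k be integers with k ≥ 2 and n ≥ 2(⌊k/2⌋+1). Assume that c(n,k) ≤ C(n,j+1) − C(n,j) for every integer j with ⌊k/2⌋+1 ≤ j ≤ ⌊n/2⌋−1.ter Then for every positive integer t, the SU(2) system with parameters (n,k,t) has no nontrivial integer solution if and only if t < c(n,k). -/
/-- Extended binomial coefficient for integer arguments: `0` unless `0 ≤ r ≤ m`. -/
def zChoose (m r : ℤ) : ℤ :=
  if 0 ≤ r ∧ r ≤ m then (m.toNat.choose r.toNat : ℤ) else 0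

/-- The quantity `c(n,k) = (2^⌊k/2⌋/(⌊k/2⌋+1)!)·∏_{α=1}^{⌊k/2⌋+1}(n−2α+1)`. -/
def su2C (n k : ℕ) : ℚ :=
  (2 ^ (k / 2) / (Nat.factorial (k / 2 + 1) : ℚ)) *
    ∏ α ∈ Finset.Icc 1 (k / 2 + 1), ((n : ℚ) - 2 * (α : ℚ) + 1)

/-- The SU(2) system with parameters `(n,k,t)` on `x = (x_0,…,x_{⌊n/2⌋})`. -/
def SU2System (n k t : ℕ) (x : ℕ → ℤ) : Prop :=
  (∑ j ∈ Finset.range (n / 2 + 1),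
      (zChoose (n : ℤ) (j : ℤ) - zChoose (n : ℤ) ((j : ℤ) - 1)) * |x j| ≤ 2 * (t : ℤ)) ∧
  ∀ l ∈ Finset.range (k / 2 + 1),
    ∑ j ∈ Finset.range (n / 2 + 1),
      (zChoose ((n : ℤ) - 2 * (l : ℤ)) ((j : ℤ) - (l : ℤ)) -
        zChoose ((n : ℤ) - 2 * (l : ℤ)) ((j : ℤ) - (l : ℤ) - 1)) * x j = 0

/-- A vector `x = (x_0,…,x_{⌊n/2⌋})` is nontrivial if some coordinate is nonzero. -/
def SU2Nontrivial (n : ℕ) (x : ℕ → ℤ) : Prop :=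
  ∃ j ∈ Finset.range (n / 2 + 1), x j ≠ 0

open PowerSeries in
theorem su2_coeff_pow (m r : ℕ) : coeff r ((1 + X : ℤ⟦X⟧) ^ m) = (m.choose r : ℤ) := by
  have h : ((1 + X : ℤ⟦X⟧) ^ m) = (((1 + Polynomial.X : Polynomial ℤ) ^ m : Polynomial ℤ) : ℤ⟦X⟧) := by
    push_cast; rfl
  rw [h, Polynomial.coeff_coe, Polynomial.coeff_one_add_X_pow]

theorem su2_zChoose (m r : ℕ) : zChoose (m : ℤ) (r : ℤ) = (m.choose r : ℤ) := by
  unfold zChoose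
  split_ifs with h
  · simp
  · rw [Nat.choose_eq_zero_of_lt (by omega)]; rfl

theorem su2_zChoose_neg (m r : ℤ) (h : r < 0) : zChoose m r = 0 := by
  unfold zChoose
  rw [if_neg (by omega)]

open PowerSeries in
theorem su2_fcoef (n l j : ℕ) (h : 2 * l ≤ n) :
    zChoose ((n : ℤ) - 2 * (l : ℤ)) ((j : ℤ) - (l : ℤ)) -
        zChoose ((n : ℤ) - 2 * (l : ℤ)) ((j : ℤ) - (l : ℤ) - 1)
      = coeff j ((X : ℤ⟦X⟧) ^ l * ((1 + X) ^ (n - 2 * l) * (1 - X))) := by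
  have hm : (n : ℤ) - 2 * (l : ℤ) = ((n - 2 * l : ℕ) : ℤ) := by omega
  rw [coeff_X_pow_mul', hm]
  split_ifs with hj
  · obtain ⟨i, rfl⟩ := Nat.exists_eq_add_of_le hj
    have h1 : ((l + i : ℕ) : ℤ) - (l : ℤ) = (i : ℤ) := by push_cast; ring
    rw [h1, su2_zChoose, mul_sub, mul_one, map_sub, Nat.add_sub_cancel_left, su2_coeff_pow]
    congr 1
    cases i with
    | zero => rw [su2_zChoose_neg _ _ (by simp)]; simp
    | succ i =>
      rw [coeff_succ_mul_X, su2_coeff_pow, ← su2_zChoose]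
      congr 1; push_cast; ring
  · rw [su2_zChoose_neg _ _ (by omega), su2_zChoose_neg _ _ (by omega)]; simp

/-- power series 1/(1-X) -/
noncomputable def su2U : PowerSeries ℤ := PowerSeries.mk 1

/-- power series 1/(1+X) -/
noncomputable def su2V : PowerSeries ℤ := PowerSeries.rescale (-1) su2U

open PowerSeries in
theorem su2U_mul : su2U * (1 - X) = 1 := PowerSeries.mk_one_mul_one_sub_eq_one ℤ

open PowerSeries in
theorem su2V_mul : su2V * (1 + X) = 1 := by
  have h := congrArg (rescale (-1 : ℤ)) su2U_mul
  rw [map_mul, map_sub, map_one, rescale_neg_one_X] at h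
  simpa [su2V] using h

open PowerSeries in
theorem su2U_coeff (d i : ℕ) : coeff i (su2U ^ (d + 1)) = ((d + i).choose d : ℤ) := by
  rw [su2U, PowerSeries.mk_one_pow_eq_mk_choose_add, coeff_mk]

open PowerSeries in
theorem su2V_coeff (d i : ℕ) : coeff i (su2V ^ (d + 1)) = (-1) ^ i * ((d + i).choose d : ℤ) := by
  rw [su2V, ← map_pow, coeff_rescale, su2U_coeff]

open PowerSeries in
theorem su2U_der : derivative ℤ su2U = su2U ^ 2 := by
  have h := congrArg (derivative ℤ) su2U_mul
  rw [Derivation.leibniz, map_sub] at h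
  simp [derivative_X] at h
  have := su2U_mul
  linear_combination su2U * h - (derivative ℤ su2U) * this

/-- The total weight. -/
noncomputable def su2T (q d : ℕ) : ℤ :=
  PowerSeries.coeff q ((1 + PowerSeries.X) ^ (2 * q + d) * su2U ^ d)

open PowerSeries in
theorem su2T_rec (q d : ℕ) :
    ((d : ℤ) + 1) * su2T q (d + 2) = (2 * q + d + 1) * su2T q d := by
  set H : ℤ⟦X⟧ := (1 + X) ^ (2 * q + d + 1) * su2U ^ (d + 1) with hH
  have hder : derivative ℤ H = (1 + X) ^ (2 * q + d + 1) * ((d + 1 : ℤ⟦X⟧) * su2U ^ (d + 2)) +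
      su2U ^ (d + 1) * ((2 * q + d + 1 : ℤ⟦X⟧) * (1 + X) ^ (2 * q + d)) := by
    rw [hH, Derivation.leibniz, Derivation.leibniz_pow, Derivation.leibniz_pow, su2U_der, map_add]
    simp [derivative_X, smul_eq_mul]
    left; left; ring
  have hc : coeff q (X * derivative ℤ H) = (q : ℤ) * coeff q H := by
    cases q with
    | zero => simp
    | succ q => rw [coeff_succ_X_mul, coeff_derivative]; push_cast; ring
  have key : C (d + 1 : ℤ) * ((1 + X) ^ (2 * q + (d + 2)) * su2U ^ (d + 2))
      - C (2 * q + d + 1 : ℤ) * ((1 + X) ^ (2 * q + d) * su2U ^ d)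
      = C (2 : ℤ) * (X * derivative ℤ H - C (q : ℤ) * H) := by
    rw [hder, hH]
    have e1 : su2U ^ (d + 1) = su2U ^ (d + 2) * (1 - X) := by
      linear_combination (- su2U ^ (d + 1)) * su2U_mul
    have e2 : su2U ^ d = su2U ^ (d + 2) * (1 - X) ^ 2 := by
      linear_combination (- su2U ^ d - su2U ^ (d + 1) * (1 - X)) * su2U_mul
    rw [e1, e2]
    simp only [map_add, map_mul, map_one, map_natCast, map_ofNat]
    ring
  have := congrArg (coeff q) key
  rw [map_sub, coeff_C_mul, coeff_C_mul, coeff_C_mul, map_sub, coeff_C_mul, hc] at this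
  unfold su2T
  linarith

open PowerSeries in
theorem su2T_zero (q : ℕ) : (su2T q 0 : ℚ) * q.factorial = 2 ^ q * ∏ i ∈ Finset.range q, (2 * (i : ℚ) + 1) := by
  have : su2T q 0 = (q.centralBinom : ℤ) := by
    rw [su2T, pow_zero, mul_one, su2_coeff_pow, Nat.centralBinom]; rfl
  rw [this]
  clear this
  induction q with
  | zero => simp
  | succ q ih =>
    rw [Finset.prod_range_succ, Nat.factorial_succ]
    have h := Nat.succ_mul_centralBinom_succ q
    have h' : ((q : ℚ) + 1) * (q + 1).centralBinom = 2 * (2 * q + 1) * q.centralBinom := by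
      exact_mod_cast h
    push_cast at *
    linear_combination (q.factorial : ℚ) * h' + 2 * (2 * q + 1) * ih

open PowerSeries in
theorem su2T_one (q : ℕ) : (su2T q 1 : ℚ) * q.factorial =
    2 ^ q * ∏ i ∈ Finset.range q, (1 + 2 * (i : ℚ) + 1) := by
  have h1 : su2T q 1 = 4 ^ q := by
    rw [su2T, pow_one, coeff_mul, Finset.Nat.sum_antidiagonal_eq_sum_range_succ_mk]
    have := Nat.sum_range_choose_halfway q
    simp only [su2_coeff_pow, su2U, coeff_mk, Pi.one_apply, mul_one]
    exact_mod_cast this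
  have h2 : ∏ i ∈ Finset.range q, (1 + 2 * (i : ℚ) + 1) = 2 ^ q * q.factorial := by
    clear h1
    induction q with
    | zero => simp
    | succ q ih => rw [Finset.prod_range_succ, ih, Nat.factorial_succ]; push_cast; ring
  rw [h1, h2]
  push_cast
  rw [show (4 : ℚ) = 2 * 2 by norm_num, mul_pow]; ring

theorem su2T_closed (q : ℕ) : ∀ d : ℕ, (su2T q d : ℚ) * q.factorial =
    2 ^ q * ∏ i ∈ Finset.range q, ((d : ℚ) + 2 * (i : ℚ) + 1)
  | 0 => by simpa using su2T_zero q
  | 1 => by simpa using su2T_one q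
  | d + 2 => by
    have ih := su2T_closed q d
    have hr : ((d : ℚ) + 1) * su2T q (d + 2) = (2 * q + d + 1) * su2T q d := by
      exact_mod_cast su2T_rec q d
    have h1 := Finset.prod_range_succ (fun i : ℕ => (d : ℚ) + 2 * (i : ℚ) + 1) q
    rw [Finset.prod_range_succ'] at h1
    have h2 : ∏ i ∈ Finset.range q, (((d + 2 : ℕ) : ℚ) + 2 * (i : ℚ) + 1)
        = ∏ i ∈ Finset.range q, ((d : ℚ) + 2 * ((i + 1 : ℕ) : ℚ) + 1) := by
      refine Finset.prod_congr rfl fun i _ => ?_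
      push_cast; ring
    rw [h2]
    have hd : (d : ℚ) + 1 ≠ 0 := by positivity
    apply mul_left_cancel₀ hd
    push_cast at *
    linear_combination (q.factorial : ℚ) * hr + (2 * q + d + 1) * ih - 2 ^ q * h1

theorem su2C_eq (n k d : ℕ) (hn : n = 2 * (k / 2 + 1) + d) :
    2 * su2C n k = (su2T (k / 2 + 1) d : ℚ) := by
  have h := su2T_closed (k / 2 + 1) d
  unfold su2C
  generalize hp : k / 2 = p at *
  have h2 : ∏ α ∈ Finset.Icc 1 (p + 1), ((n : ℚ) - 2 * (α : ℚ) + 1)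
      = ∏ i ∈ Finset.range (p + 1), ((d : ℚ) + 2 * (i : ℚ) + 1) := by
    refine Finset.prod_nbij' (fun α => p + 1 - α) (fun i => p + 1 - i) ?_ ?_ ?_ ?_ ?_
    · intro a ha; simp only [Finset.mem_Icc, Finset.mem_range] at *; omega
    · intro a ha; simp only [Finset.mem_Icc, Finset.mem_range] at *; omega
    · intro a ha; simp only [Finset.mem_Icc] at *; omega
    · intro a ha; simp only [Finset.mem_range] at *; omega
    · intro a ha
      have ha' : a ≤ p + 1 := (Finset.mem_Icc.mp ha).2
      rw [hn, Nat.cast_sub ha']; push_cast; ring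
  rw [h2]
  have hf : ((p + 1).factorial : ℚ) ≠ 0 := by positivity
  field_simp
  linear_combination -h

/-- Fundamental solution. -/
def su2Y (q d : ℕ) (j : ℕ) : ℤ :=
  if j ≤ q then (-1) ^ (q - j) * ((d + (q - j)).choose d : ℤ) else 0

/-- Coefficients of the linear conditions. -/
def su2F (n l j : ℕ) : ℤ :=
  zChoose ((n : ℤ) - 2 * (l : ℤ)) ((j : ℤ) - (l : ℤ)) -
        zChoose ((n : ℤ) - 2 * (l : ℤ)) ((j : ℤ) - (l : ℤ) - 1)

theorem su2F_lt (n l j : ℕ) (h : j < l) : su2F n l j = 0 := by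
  rw [su2F, su2_zChoose_neg _ _ (by omega), su2_zChoose_neg _ _ (by omega)]; rfl

theorem su2F_self (n l : ℕ) (h : 2 * l ≤ n) : su2F n l l = 1 := by
  rw [su2F, su2_zChoose_neg _ _ (by omega : (l : ℤ) - l - 1 < 0), sub_self, zChoose,
    if_pos (by omega)]
  simp

theorem su2_sum_trunc (N q : ℕ) (hq : q ≤ N) (f : ℕ → ℤ) (hf : ∀ j, q < j → f j = 0) :
    ∑ j ∈ Finset.range (N + 1), f j = ∑ j ∈ Finset.range (q + 1), f j := by
  symm
  apply Finset.sum_subset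
  · intro j; simp only [Finset.mem_range]; omega
  · intro j _ hj
    exact hf j (by simp only [Finset.mem_range] at hj; omega)

open PowerSeries in
theorem su2Y_sol (q d N l : ℕ) (hq : q ≤ N) (hl : l < q) :
    ∑ j ∈ Finset.range (N + 1), su2F (2 * q + d) l j * su2Y q d j = 0 := by
  rw [su2_sum_trunc N q hq _ (fun j hj => by simp [su2Y, Nat.not_le.mpr hj])]
  have h1 : ∑ j ∈ Finset.range (q + 1), su2F (2 * q + d) l j * su2Y q d j =
      coeff q (((X : ℤ⟦X⟧) ^ l * ((1 + X) ^ (2 * q + d - 2 * l) * (1 - X))) * su2V ^ (d + 1)) := by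
    rw [coeff_mul, Finset.Nat.sum_antidiagonal_eq_sum_range_succ_mk]
    refine Finset.sum_congr rfl fun j hj => ?_
    have hj' : j ≤ q := by simp only [Finset.mem_range] at hj; omega
    simp only [su2Y, if_pos hj', su2V_coeff]
    rw [su2F, su2_fcoef _ _ _ (by omega)]
  rw [h1]
  obtain ⟨r, rfl⟩ : ∃ r, q = l + (r + 1) := ⟨q - l - 1, by omega⟩
  have e : 2 * (l + (r + 1)) + d - 2 * l = (2 * r + 1) + (d + 1) := by omega
  have h2 : ((X : ℤ⟦X⟧) ^ l * ((1 + X) ^ ((2 * r + 1) + (d + 1)) * (1 - X))) * su2V ^ (d + 1)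
      = X ^ l * ((1 + X) ^ (2 * r + 1) * (1 - X)) := by
    have : (su2V * (1 + X)) ^ (d + 1) = 1 := by rw [su2V_mul, one_pow]
    rw [mul_pow] at this
    rw [pow_add]
    linear_combination (X ^ l * ((1 + X) ^ (2 * r + 1) * (1 - X))) * this
  rw [e, h2, coeff_X_pow_mul', if_pos (by omega), Nat.add_sub_cancel_left, mul_sub, mul_one,
    map_sub, coeff_succ_mul_X, su2_coeff_pow, su2_coeff_pow, Nat.choose_symm_half, sub_self]

open PowerSeries in
theorem su2Y_weight (q d N : ℕ) (hq : q ≤ N) :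
    ∑ j ∈ Finset.range (N + 1), su2F (2 * q + d) 0 j * |su2Y q d j| = su2T q d := by
  rw [su2_sum_trunc N q hq _ (fun j hj => by simp [su2Y, Nat.not_le.mpr hj])]
  have h1 : ∑ j ∈ Finset.range (q + 1), su2F (2 * q + d) 0 j * |su2Y q d j| =
      coeff q (((X : ℤ⟦X⟧) ^ 0 * ((1 + X) ^ (2 * q + d - 2 * 0) * (1 - X))) * su2U ^ (d + 1)) := by
    rw [coeff_mul, Finset.Nat.sum_antidiagonal_eq_sum_range_succ_mk]
    refine Finset.sum_congr rfl fun j hj => ?_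
    have hj' : j ≤ q := by simp only [Finset.mem_range] at hj; omega
    simp only [su2Y, if_pos hj', su2U_coeff, abs_mul, abs_pow, abs_neg, abs_one, one_pow, one_mul,
      Nat.abs_cast]
    rw [su2F, su2_fcoef _ _ _ (by omega)]
  rw [h1, su2T]
  congr 1
  simp only [pow_zero, one_mul, mul_zero, Nat.sub_zero]
  linear_combination ((1 + X) ^ (2 * q + d) * su2U ^ d) * su2U_mul

theorem su2F_zero (n j : ℕ) : su2F n 0 (j + 1) = (n.choose (j + 1) : ℤ) - (n.choose j : ℤ) := by
  have h1 := su2_zChoose n (j + 1)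
  have h2 := su2_zChoose n j
  rw [su2F, ← h1, ← h2]
  simp

theorem su2F_nonneg (n j : ℕ) (hj : j ≤ n / 2) : 0 ≤ su2F n 0 j := by
  cases j with
  | zero => rw [su2F_self n 0 (by omega)]; norm_num
  | succ j =>
    rw [su2F_zero]
    have := Nat.choose_le_succ_of_lt_half_left (r := j) (n := n) (by omega)
    have : (n.choose j : ℤ) ≤ n.choose (j + 1) := by exact_mod_cast this
    linarith

theorem su2_unique (n N q : ℕ) (hq : q ≤ N) (hn : 2 * q ≤ n) (z : ℕ → ℤ)
    (hz : ∀ j, q ≤ j → j ≤ N → z j = 0)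
    (h : ∀ l < q, ∑ j ∈ Finset.range (N + 1), su2F n l j * z j = 0) :
    ∀ j ≤ N, z j = 0 := by
  have key : ∀ i ≤ q, ∀ j, q - i ≤ j → j ≤ N → z j = 0 := by
    intro i
    induction i with
    | zero => intro _ j h1 h2; exact hz j (by omega) h2
    | succ i ih =>
      intro hi j h1 h2
      rcases Nat.lt_or_ge j (q - i) with hlt | hge
      · have hs := h j (by omega)
        rw [Finset.sum_eq_single j] at hs
        · rwa [su2F_self n j (by omega), one_mul] at hs
        · intro b hb hbj
          have hb' : b ≤ N := by simp only [Finset.mem_range] at hb; omega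
          rcases Nat.lt_or_ge b j with hbl | hbg
          · rw [su2F_lt _ _ _ hbl, zero_mul]
          · rw [ih (by omega) b (by omega) hb', mul_zero]
        · intro hj; exact absurd (Finset.mem_range.mpr (by omega)) hj
      · exact ih (by omega) j hge h2
  intro j hj
  exact key q le_rfl j (by omega) hj

theorem su2System_iff (n k t : ℕ) (x : ℕ → ℤ) : SU2System n k t x ↔
    (∑ j ∈ Finset.range (n / 2 + 1), su2F n 0 j * |x j| ≤ 2 * (t : ℤ)) ∧
    ∀ l < k / 2 + 1, ∑ j ∈ Finset.range (n / 2 + 1), su2F n l j * x j = 0 := by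
  unfold SU2System su2F
  simp only [Finset.mem_range, Nat.cast_zero, mul_zero, sub_zero]

/-- Lemma (SU2_nontrivial_nonexistence): under the stated binomial hypothesis,
the SU(2) system has no nontrivial integer solution iff `t < c(n,k)`. -/
theorem SU2_nontrivial_nonexistence (n k : ℕ) (hk : 2 ≤ k)
    (hn : 2 * (k / 2 + 1) ≤ n)
    (hbinom : ∀ j : ℕ, k / 2 + 1 ≤ j → j ≤ n / 2 - 1 →
      su2C n k ≤ (n.choose (j + 1) : ℚ) - (n.choose j : ℚ)) :
    ∀ t : ℕ, 0 < t →
      ((¬ ∃ x : ℕ → ℤ, SU2Nontrivial n x ∧ SU2System n k t x) ↔ (t : ℚ) < su2C n k) := by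
  intro t _
  obtain ⟨d, hd⟩ := Nat.exists_eq_add_of_le hn
  have hc := su2C_eq n k d hd
  simp only [su2System_iff]
  generalize su2C n k = c at *
  have hq0 : 0 < k / 2 + 1 := by omega
  generalize k / 2 + 1 = q at *
  have hqN : q ≤ n / 2 := by omega
  have hw := su2Y_weight q d (n / 2) hqN
  have hs := fun l hl => su2Y_sol q d (n / 2) l hqN hl
  rw [← hd] at hw hs
  have hyq : su2Y q d q = 1 := by simp [su2Y]
  have hTnn : 0 ≤ su2T q d := by
    rw [← hw]
    refine Finset.sum_nonneg fun j hj => mul_nonneg (su2F_nonneg n j ?_) (abs_nonneg _)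
    simp only [Finset.mem_range] at hj; omega
  constructor
  · intro hno
    by_contra hlt
    refine hno ⟨su2Y q d, ⟨q, Finset.mem_range.mpr (by omega), by rw [hyq]; norm_num⟩, ?_, hs⟩
    rw [hw]
    have : (su2T q d : ℚ) ≤ 2 * (t : ℚ) := by linarith
    exact_mod_cast this
  · rintro hlt ⟨x, ⟨j₀, hj₀, hx₀⟩, hx1, hx2⟩
    by_cases hbig : ∃ j, q < j ∧ j ≤ n / 2 ∧ x j ≠ 0
    · obtain ⟨j, hj1, hj2, hxj⟩ := hbig
      have hmem : j ∈ Finset.range (n / 2 + 1) := Finset.mem_range.mpr (by omega)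
      have h0 := hx2 0 (by omega)
      rw [← Finset.add_sum_erase _ _ hmem] at h0 hx1
      have hle : |∑ i ∈ (Finset.range (n / 2 + 1)).erase j, su2F n 0 i * x i| ≤
          ∑ i ∈ (Finset.range (n / 2 + 1)).erase j, su2F n 0 i * |x i| := by
        refine (Finset.abs_sum_le_sum_abs _ _).trans (le_of_eq ?_)
        refine Finset.sum_congr rfl fun i hi => ?_
        have hi' := Finset.mem_range.mp (Finset.mem_of_mem_erase hi)
        rw [abs_mul, abs_of_nonneg (su2F_nonneg n i (by omega))]
      have he : ∑ i ∈ (Finset.range (n / 2 + 1)).erase j, su2F n 0 i * x i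
          = -(su2F n 0 j * x j) := by linarith
      have hF := su2F_nonneg n j hj2
      rw [he, abs_neg, abs_mul, abs_of_nonneg hF] at hle
      have hone : 1 ≤ |x j| := Int.one_le_abs hxj
      have hmt : su2F n 0 j ≤ t := by nlinarith
      obtain ⟨i, rfl⟩ : ∃ i, j = i + 1 := ⟨j - 1, by omega⟩
      have hb := hbinom i (by omega) (by omega)
      rw [su2F_zero] at hmt
      have hmt' : (n.choose (i + 1) : ℚ) - (n.choose i : ℚ) ≤ t := by exact_mod_cast hmt
      linarith
    · push Not at hbig
      have hz := su2_unique n (n / 2) q hqN hn (fun j => x j - x q * su2Y q d j)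
        (by
          intro j h1 h2
          rcases Nat.eq_or_lt_of_le h1 with rfl | h1
          · simp [hyq]
          · simp [hbig j h1 h2, su2Y, Nat.not_le.mpr h1])
        (by
          intro l hl
          have e : ∑ j ∈ Finset.range (n / 2 + 1), su2F n l j * (x j - x q * su2Y q d j)
              = ∑ j ∈ Finset.range (n / 2 + 1), su2F n l j * x j
                - x q * ∑ j ∈ Finset.range (n / 2 + 1), su2F n l j * su2Y q d j := by
            rw [Finset.mul_sum, ← Finset.sum_sub_distrib]
            exact Finset.sum_congr rfl fun j _ => by ring
          rw [e, hx2 l hl, hs l hl]; ring)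
      have hx : ∀ j ≤ n / 2, x j = x q * su2Y q d j := fun j hj => sub_eq_zero.mp (hz j hj)
      have hxq : x q ≠ 0 := by
        intro h
        apply hx₀
        rw [hx j₀ (by simp only [Finset.mem_range] at hj₀; omega), h, zero_mul]
      have e : ∑ j ∈ Finset.range (n / 2 + 1), su2F n 0 j * |x j| = |x q| * su2T q d := by
        rw [← hw, Finset.mul_sum]
        refine Finset.sum_congr rfl fun j hj => ?_
        rw [hx j (by simp only [Finset.mem_range] at hj; omega), abs_mul]; ring
      rw [e] at hx1
      have hone : 1 ≤ |x q| := Int.one_le_abs hxq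
      have : su2T q d ≤ 2 * (t : ℤ) := by nlinarith
      have : (su2T q d : ℚ) ≤ 2 * (t : ℚ) := by exact_mod_cast this
      linarith
end

section
/- Let n and k be integers with k ≥ 2 and n ≥ 2^{2(⌊k/2⌋+1)}. Then c(n,k) ≤ C(n,j+1) − C(n,j) for every integer j with ⌊k/2⌋+1 ≤ j ≤ ⌊n/2⌋−1. -/
lemma su2_prod_bound (n m : ℕ) (h : 2 * m ≤ n) :
    0 ≤ ∏ α ∈ Finset.Icc 1 m, ((n : ℚ) - 2 * (α : ℚ) + 1) ∧
    ∏ α ∈ Finset.Icc 1 m, ((n : ℚ) - 2 * (α : ℚ) + 1) ≤ (n.descFactorial m : ℚ) := by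
  induction m with
  | zero => simp
  | succ m ih =>
    obtain ⟨h0, h1⟩ := ih (by omega)
    rw [Finset.prod_Icc_succ_top (by omega), Nat.descFactorial_succ]
    have hq : (2 * ((m : ℚ) + 1)) ≤ n := by exact_mod_cast h
    have hm : (0 : ℚ) ≤ m := Nat.cast_nonneg m
    push_cast [Nat.cast_sub (show m ≤ n by omega)]
    have hp : (0 : ℚ) ≤ n - 2 * (m + 1) + 1 := by linarith
    refine ⟨mul_nonneg h0 hp, ?_⟩
    rw [mul_comm]
    exact mul_le_mul (by linarith) h1 h0 (by linarith)

lemma su2_choose_step (n j : ℕ) (h : j ≤ n) :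
    (n.choose (j + 1) : ℚ) = n.choose j * ((n : ℚ) - j) / (j + 1) := by
  have := Nat.choose_succ_right_eq n j
  have h2 : (n.choose (j + 1) : ℚ) * (j + 1) = n.choose j * ((n : ℚ) - j) := by
    rw [← Nat.cast_sub h]
    exact_mod_cast this
  rw [eq_div_iff (by positivity), h2]

lemma su2_mono (n a j : ℕ) (haj : a ≤ j) (h : 2 * j ≤ n) :
    (n.choose a : ℚ) / (a + 1) ≤ n.choose j / (j + 1) := by
  induction j, haj using Nat.le_induction with
  | base => exact le_rfl
  | succ j _ ih =>
    refine (ih (by omega)).trans ?_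
    rw [su2_choose_step n j (by omega)]
    have hq : (2 * ((j : ℚ) + 1)) ≤ n := by exact_mod_cast h
    have hc : (0 : ℚ) ≤ n.choose j / (j + 1) := by positivity
    rw [le_div_iff₀ (by positivity), mul_div_right_comm]
    push_cast
    exact mul_le_mul_of_nonneg_left (by linarith) hc

lemma su2_two_pow (i : ℕ) : i + 1 ≤ 2 ^ i := Nat.lt_two_pow_self

lemma su2_core (n m j : ℕ) (p : ℚ) (hm : (m : ℚ) ≤ p) (hp : 2 ≤ p)
    (hn : 4 * p ^ 2 ≤ n) (hmj : m ≤ j) (hj : 2 * j + 2 ≤ n) :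
    p * n.choose m ≤ (n.choose (j + 1) : ℚ) - n.choose j := by
  have hm0 : (0 : ℚ) ≤ m := Nat.cast_nonneg m
  have hC : (0 : ℚ) ≤ n.choose m := Nat.cast_nonneg _
  have hmp : p * m ≤ p * p := mul_le_mul_of_nonneg_left hm (by linarith)
  have hpp : 2 * p ≤ p * p := mul_le_mul_of_nonneg_right hp (by linarith)
  have hjq : 2 * (j : ℚ) + 2 ≤ n := by exact_mod_cast hj
  have e : (n.choose (j + 1) : ℚ) - n.choose j
      = n.choose j * (((n : ℚ) - 2 * j - 1) / (j + 1)) := by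
    rw [su2_choose_step n j (by omega)]
    field_simp
    ring
  rcases Nat.lt_or_ge j (m + 2) with hlt | hge
  · obtain rfl | rfl : j = m ∨ j = m + 1 := by omega
    · rw [e, mul_comm]
      apply mul_le_mul_of_nonneg_left _ hC
      rw [le_div_iff₀ (by positivity)]
      nlinarith
    · rw [e, su2_choose_step n m (by omega), mul_div_assoc, mul_assoc, mul_comm p]
      apply mul_le_mul_of_nonneg_left _ hC
      push_cast
      have h1 : p ≤ ((n : ℚ) - m) / (m + 1) := by
        rw [le_div_iff₀ (by positivity)]
        nlinarith
      have h2 : 1 ≤ ((n : ℚ) - 2 * (m + 1) - 1) / (m + 1 + 1) := by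
        rw [le_div_iff₀ (by positivity)]
        nlinarith
      calc p = p * 1 := by ring
        _ ≤ _ := mul_le_mul h1 h2 (by norm_num) (by linarith)
  · have h1 : (n.choose (m + 2) : ℚ) / ((m + 2 : ℕ) + 1) ≤ n.choose j / (j + 1) :=
      su2_mono n (m + 2) j hge (by omega)
    have h2 : (n.choose j : ℚ) / (j + 1) ≤ n.choose j * (((n : ℚ) - 2 * j - 1) / (j + 1)) := by
      rw [div_eq_mul_one_div]
      gcongr
      linarith
    rw [e]
    refine le_trans ?_ (h1.trans h2)
    rw [su2_choose_step n (m + 1) (by omega), su2_choose_step n m (by omega)]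
    push_cast
    have h3 : p ≤ ((n : ℚ) - m) * (n - (m + 1)) / ((m + 1) * (m + 1 + 1) * (m + 2 + 1)) := by
      rw [le_div_iff₀ (by positivity)]
      have a1 : p * ((m + 1) * (m + 1 + 1) * (m + 2 + 1))
          ≤ p * ((p + 1) * (p + 1 + 1) * (p + 2 + 1)) := by gcongr
      have a2 : (4 * p ^ 2 - p) * (4 * p ^ 2 - (p + 1)) ≤ ((n : ℚ) - m) * (n - (m + 1)) := by
        apply mul_le_mul <;> nlinarith
      refine a1.trans (le_trans ?_ a2)
      obtain ⟨q, rfl⟩ : ∃ q, p = q + 2 := ⟨p - 2, by ring⟩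
      have hq : 0 ≤ q := by linarith
      rw [← sub_nonneg]
      ring_nf
      positivity
    calc p * (n.choose m : ℚ) = n.choose m * p := by ring
      _ ≤ n.choose m * _ := mul_le_mul_of_nonneg_left h3 hC
      _ = _ := by field_simp

/-- Lemma (SU2_sufficient_cond): if `n ≥ 2^{2(⌊k/2⌋+1)}` then
`c(n,k) ≤ C(n,j+1) − C(n,j)` for all `⌊k/2⌋+1 ≤ j ≤ ⌊n/2⌋−1`. -/
theorem SU2_sufficient_cond (n k : ℕ) (hk : 2 ≤ k)
    (hn : 2 ^ (2 * (k / 2 + 1)) ≤ n) :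
    ∀ j : ℕ, k / 2 + 1 ≤ j → j ≤ n / 2 - 1 →
      su2C n k ≤ (n.choose (j + 1) : ℚ) - (n.choose j : ℚ) := by
  intro j h1 h2
  unfold su2C
  have hi : 1 ≤ k / 2 := by omega
  generalize k / 2 = i at *
  have hj : 2 * j + 2 ≤ n := by omega
  have hip := su2_two_pow i
  have hnq : 4 * ((2 : ℚ) ^ i) ^ 2 ≤ n := by
    have : 4 * (2 ^ i) ^ 2 ≤ n := by
      refine le_trans (le_of_eq ?_) hn
      ring
    exact_mod_cast this
  have hmq : ((i + 1 : ℕ) : ℚ) ≤ 2 ^ i := by exact_mod_cast hip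
  have hp2 : (2 : ℚ) ≤ 2 ^ i := by
    have : 2 ≤ 2 ^ i := by omega
    exact_mod_cast this
  refine le_trans ?_ (su2_core n (i + 1) j (2 ^ i) hmq hp2 hnq h1 hj)
  have hb := (su2_prod_bound n (i + 1) (by omega)).2
  rw [Nat.descFactorial_eq_factorial_mul_choose] at hb
  push_cast at hb
  have hf : (0 : ℚ) < (Nat.factorial (i + 1) : ℚ) := by positivity
  rw [div_mul_eq_mul_div, div_le_iff₀ hf, mul_assoc]
  apply mul_le_mul_of_nonneg_left _ (by positivity)
  rw [mul_comm (Nat.choose _ _ : ℚ)]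
  exact hb
end

section
/- Let n, a, b be integers with 0 ≤ a ≤ b ≤ n/2 − 1. Then for every integer j with a ≤ j ≤ b, C(n,j+1) − C(n,j) ≥ min{ C(n,a+1) − C(n,a), C(n,b+1) − C(n,b) }. -/
lemma aux_key (n j : ℕ) (h : j + 2 ≤ n) :
    ((j : ℤ) + 1) * (j + 2) * ((n.choose (j + 2) : ℤ) - 2 * n.choose (j + 1) + n.choose j)
      = n.choose j * (((n : ℤ) - 2 * j - 2) ^ 2 - (n + 2)) := by
  have h1 := Nat.choose_succ_right_eq n j
  have h2 := Nat.choose_succ_right_eq n (j + 1)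
  zify [show j ≤ n by omega, show j + 1 ≤ n by omega] at h1 h2
  rw [show j + 1 + 1 = j + 2 from rfl] at h2
  linear_combination ((j : ℤ) + 1) * h2 + ((n : ℤ) - j - 1 - 2 * (j + 2)) * h1

lemma aux_up (n j : ℕ) (h : j + 2 ≤ n) (hs : (n : ℤ) + 2 ≤ ((n : ℤ) - 2 * j - 2) ^ 2) :
    (n.choose (j + 1) : ℤ) - n.choose j ≤ (n.choose (j + 2) : ℤ) - n.choose (j + 1) := by
  have hk := aux_key n j h
  have h0 : (0 : ℤ) ≤ n.choose j * (((n : ℤ) - 2 * j - 2) ^ 2 - (n + 2)) :=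
    mul_nonneg (by positivity) (by linarith)
  rw [← hk] at h0
  have := nonneg_of_mul_nonneg_right h0 (by positivity)
  linarith

lemma aux_down (n j : ℕ) (h : j + 2 ≤ n) (hs : ((n : ℤ) - 2 * j - 2) ^ 2 ≤ (n : ℤ) + 2) :
    (n.choose (j + 2) : ℤ) - n.choose (j + 1) ≤ (n.choose (j + 1) : ℤ) - n.choose j := by
  have hk := aux_key n j h
  have h0 : (0 : ℤ) ≤ n.choose j * ((n + 2) - ((n : ℤ) - 2 * j - 2) ^ 2) :=
    mul_nonneg (by positivity) (by linarith)
  have h1 : (0 : ℤ) ≤ ((j : ℤ) + 1) * (j + 2) *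
      (-((n.choose (j + 2) : ℤ) - 2 * n.choose (j + 1) + n.choose j)) := by linarith
  have := nonneg_of_mul_nonneg_right h1 (by positivity)
  linarith

/-- Lemma (binomial_SU2): on `{a,…,b}` with `2b+2 ≤ n`, the sequence
`j ↦ C(n,j+1) − C(n,j)` attains its minimum at an endpoint. -/
theorem binomial_SU2 (n a b : ℕ) (hab : a ≤ b) (hbn : 2 * b + 2 ≤ n) :
    ∀ j : ℕ, a ≤ j → j ≤ b →
      min ((n.choose (a + 1) : ℤ) - (n.choose a : ℤ))
          ((n.choose (b + 1) : ℤ) - (n.choose b : ℤ)) ≤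
        (n.choose (j + 1) : ℤ) - (n.choose j : ℤ) := by
  intro j haj hjb
  rcases le_total ((n : ℤ) + 2) (((n : ℤ) - 2 * j - 2) ^ 2) with hs | hs
  · refine (min_le_left _ _).trans ?_
    have key : ∀ i, a ≤ i → i ≤ j →
        (n.choose (a + 1) : ℤ) - n.choose a ≤ (n.choose (i + 1) : ℤ) - n.choose i := by
      intro i hai
      induction i, hai using Nat.le_induction with
      | base => intro _; exact le_rfl
      | succ i hai ih =>
        intro hij
        refine (ih (by omega)).trans (aux_up n i (by omega) (hs.trans ?_))
        have h1 : (0 : ℤ) ≤ (n : ℤ) - 2 * j - 2 := by omega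
        exact pow_le_pow_left₀ h1 (by omega) 2
    exact key j haj le_rfl
  · refine (min_le_right _ _).trans ?_
    have key : ∀ i, j ≤ i → i ≤ b →
        (n.choose (i + 1) : ℤ) - n.choose i ≤ (n.choose (j + 1) : ℤ) - n.choose j := by
      intro i hai
      induction i, hai using Nat.le_induction with
      | base => intro _; exact le_rfl
      | succ i hai ih =>
        intro hij
        refine (aux_down n i (by omega) (le_trans ?_ hs)).trans (ih (by omega))
        have h1 : (0 : ℤ) ≤ (n : ℤ) - 2 * i - 2 := by omega
        exact pow_le_pow_left₀ h1 (by omega) 2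
    exact key b hjb le_rfl
end

section
/- Let n and k be integers with k ≥ 2 and n ≥ 2^{2(⌊k/2⌋+1)}, and let t be a positive integer. Then the SU(2) system with parameters (n,k,t) has no nontrivial integer solution if and only if t < c(n,k) = (2^{⌊k/2⌋}/(⌊k/2⌋+1)!)·∏_{α=1}^{⌊k/2⌋+1}(n−2α+1). -/
/-- Ballot numbers `C(m,j) - C(m,j-1)`. -/
def dd : ℕ → ℕ → ℤ
  | _, 0 => 1
  | m, (j+1) => (m.choose (j+1) : ℤ) - (m.choose j : ℤ)

lemma choose_step (n j : ℕ) :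
    ((n.choose (j+1) : ℕ) : ℚ) * (j+1) = (n.choose j : ℚ) * ((n:ℚ) - j) := by
  rcases le_or_gt j n with h | h
  · have := Nat.choose_succ_right_eq n j
    have h2 : ((n.choose (j+1) * (j+1) : ℕ) : ℚ) = ((n.choose j * (n-j) : ℕ) : ℚ) := by rw [this]
    push_cast [Nat.cast_sub h] at h2
    exact h2
  · rw [Nat.choose_eq_zero_of_lt h, Nat.choose_eq_zero_of_lt (by omega)]; simp

lemma dd_formula (n j : ℕ) :
    (dd n j : ℚ) * ((n:ℚ) - j + 1) = (n.choose j : ℚ) * ((n:ℚ) - 2 * j + 1) := by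
  cases j with
  | zero => simp [dd]
  | succ j =>
    have := choose_step n j
    simp only [dd]; push_cast
    linear_combination this

lemma dd_pascal (m j : ℕ) : dd (m+1) (j+1) = dd m (j+1) + dd m j := by
  cases j with
  | zero => simp [dd]
  | succ j =>
    simp only [dd, Nat.choose_succ_succ (n := m)]; push_cast; ring

lemma dd_nonneg (m j : ℕ) (h : 2 * j ≤ m + 1) : 0 ≤ dd m j := by
  rcases Nat.eq_zero_or_pos j with rfl | hj
  · simp [dd]
  have h1 := dd_formula m j
  have h2 : (0:ℚ) < (m:ℚ) - j + 1 := by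
    have : (2 * j : ℚ) ≤ m + 1 := by exact_mod_cast h
    have : (1:ℚ) ≤ j := by exact_mod_cast hj
    linarith
  have h3 : (0:ℚ) ≤ (m.choose j : ℚ) * ((m:ℚ) - 2 * j + 1) := by
    have : (2 * j : ℚ) ≤ m + 1 := by exact_mod_cast h
    apply mul_nonneg (by positivity); linarith
  rw [← h1] at h3
  have := nonneg_of_mul_nonneg_left h3 h2
  exact_mod_cast this

lemma dd_diag (m j i : ℕ) (h : 2 * (j + i) ≤ m + i) : dd m j ≤ dd (m+i) (j+i) := by
  induction i with
  | zero => simp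
  | succ i ih =>
    have := ih (by omega)
    have h2 := dd_pascal (m+i) (j+i)
    have h3 := dd_nonneg (m+i) (j+i+1) (by omega)
    rw [← add_assoc, ← add_assoc, h2]; linarith

lemma choose_prod (n j : ℕ) :
    ((n.choose j : ℕ) : ℚ) * (j.factorial : ℚ) = ∏ i ∈ Finset.range j, ((n:ℚ) - i) := by
  induction j with
  | zero => simp
  | succ j ih =>
    rw [Finset.prod_range_succ, ← ih, Nat.factorial_succ]
    push_cast
    linear_combination (j.factorial : ℚ) * choose_step n j

lemma dd_prod (n j : ℕ) :
    (dd n (j+1) : ℚ) * ((j+1).factorial : ℚ)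
      = (∏ i ∈ Finset.range j, ((n:ℚ) - i)) * ((n:ℚ) - 2 * j - 1) := by
  rw [← choose_prod, Nat.factorial_succ]
  simp only [dd]; push_cast
  linear_combination (j.factorial : ℚ) * choose_step n j

/-- partial sums of the alternating sum -/
lemma alt_partial (n M J : ℕ) (hJ : J ≤ M) (h : 2 * M ≤ n) :
    (M : ℚ) * ∑ j ∈ Finset.range (J+1), (-1:ℚ)^j * (dd n j : ℚ) * ((n - M - j).choose (M - j) : ℚ)
      = (-1)^J * ((M:ℚ) - J) * (n.choose J : ℚ) * ((n - M - J).choose (M - J) : ℚ) := by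
  induction J with
  | zero => simp [dd]
  | succ J ih =>
    rw [Finset.sum_range_succ, mul_add, ih (by omega)]
    obtain ⟨a, rfl⟩ : ∃ a, M = J + 1 + a := ⟨M - (J+1), by omega⟩
    obtain ⟨b, rfl⟩ : ∃ b, n = 2 * (J+1+a) + b := ⟨n - 2 * (J+1+a), by omega⟩
    have e1 : 2 * (J+1+a) + b - (J+1+a) - J = a + b + 1 := by omega
    have e2 : J + 1 + a - J = a + 1 := by omega
    have e3 : 2 * (J+1+a) + b - (J+1+a) - (J+1) = a + b := by omega
    have e4 : J + 1 + a - (J + 1) = a := by omega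
    rw [e1, e2, e3, e4]
    have p1 : (((a+b+1).choose (a+1) : ℕ) : ℚ) * (a+1) = (a+b+1) * ((a+b).choose a : ℚ) := by
      exact_mod_cast (Nat.add_one_mul_choose_eq (a+b) a).symm
    have p2 := choose_step (2 * (J+1+a) + b) J
    simp only [dd]
    push_cast at p2 ⊢
    generalize ((2 * (J+1+a) + b).choose (J+1) : ℚ) = u at *
    generalize ((2 * (J+1+a) + b).choose J : ℚ) = v at *
    generalize ((a+b).choose a : ℚ) = p at *
    generalize ((a+b+1).choose (a+1) : ℚ) = q at *
    rw [pow_succ]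
    linear_combination (-1)^J * v * p1 - (-1)^J * p * p2

lemma alt_sum (n M : ℕ) (hM : 0 < M) (h : 2 * M ≤ n) :
    ∑ j ∈ Finset.range (M+1), (-1:ℤ)^j * dd n j * ((n - M - j).choose (M - j) : ℤ) = 0 := by
  have := alt_partial n M M le_rfl h
  simp only [sub_self, mul_zero, zero_mul, mul_eq_zero] at this
  rcases this with h0 | h0
  · have : M = 0 := by exact_mod_cast h0
    omega
  · exact_mod_cast h0

lemma tele_partial (n M J : ℕ) (hJ : J ≤ M) (h : 2 * (M+1) ≤ n) :
    ∑ j ∈ Finset.range (J+1), (((M:ℚ)+1) * ((dd n j : ℚ) * ((n - (M+1) - j).choose (M+1 - j) : ℚ))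
       - 2 * ((n:ℚ) - 2 * M - 1) * ((dd n j : ℚ) * ((n - M - j).choose (M - j) : ℚ)))
      = - ((n.choose J : ℚ) * ((n:ℚ) - 2 * J) * ((n - (M+1) - (J+1)).choose (M - J) : ℚ)
          * ((n:ℚ) - M - 1 - J) / ((n:ℚ) - 2 * M)) := by
  have key : ∀ J ≤ M, (((M:ℚ)+1) * ((dd n J : ℚ) * ((n - (M+1) - J).choose (M+1 - J) : ℚ))
       - 2 * ((n:ℚ) - 2 * M - 1) * ((dd n J : ℚ) * ((n - M - J).choose (M - J) : ℚ)))
      = - ((n.choose J : ℚ) * ((n:ℚ) - 2 * J) * ((n - (M+1) - (J+1)).choose (M - J) : ℚ)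
          * ((n:ℚ) - M - 1 - J) / ((n:ℚ) - 2 * M))
        + ((n.choose J : ℚ) * J / ((n:ℚ) - J + 1)) * ((n:ℚ) - 2 * J + 2)
          * ((n - (M+1) - J).choose (M + 1 - J) : ℚ) * ((n:ℚ) - M - J) / ((n:ℚ) - 2 * M) := by
    intro J hJ
    obtain ⟨a, rfl⟩ : ∃ a, M = J + a := ⟨M - J, by omega⟩
    obtain ⟨b, rfl⟩ : ∃ b, n = 2 * (J+a+1) + b := ⟨n - 2 * (J+a+1), by omega⟩
    have e1 : 2 * (J+a+1) + b - (J+a+1) - J = a + b + 1 := by omega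
    have e2 : J + a + 1 - J = a + 1 := by omega
    have e3 : 2 * (J+a+1) + b - (J+a+1) - (J+1) = a + b := by omega
    have e4 : J + a - J = a := by omega
    have e5 : 2 * (J+a+1) + b - (J+a) - J = a + b + 2 := by omega
    rw [e1, e2, e3, e4, e5]
    have p1 : (((a+b+1).choose (a+1) : ℕ) : ℚ) * (a+1) = (a+b+1) * ((a+b).choose a : ℚ) := by
      exact_mod_cast (Nat.add_one_mul_choose_eq (a+b) a).symm
    have p2 : (((a+b+2).choose a : ℕ) : ℚ) * (b+2) * (b+1)
        = (a+b+2) * (a+b+1) * ((a+b).choose a : ℚ) := by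
      have h1 := Nat.choose_mul_succ_eq (a+b) a
      have h2 := Nat.choose_mul_succ_eq (a+b+1) a
      have h3 : a + b + 1 - a = b + 1 := by omega
      have h4 : a + b + 1 + 1 - a = b + 2 := by omega
      rw [h3] at h1
      rw [h4] at h2
      have h1' : ((a+b).choose a : ℚ) * (a+b+1) = ((a+b+1).choose a : ℚ) * (b+1) := by
        exact_mod_cast h1
      have h2' : ((a+b+1).choose a : ℚ) * (a+b+1+1) = ((a+b+2).choose a : ℚ) * (b+2) := by
        exact_mod_cast h2
      linear_combination (-(b+1:ℚ)) * h2' - (a+b+2:ℚ) * h1'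
    have p3 := dd_formula (2 * (J+a+1) + b) J
    have q1 : (((a+b+1).choose (a+1) : ℕ) : ℚ) = (a+b+1) * ((a+b).choose a : ℚ) / (a+1) := by
      field_simp; linear_combination p1
    have q2 : (((a+b+2).choose a : ℕ) : ℚ) = (a+b+2) * (a+b+1) * ((a+b).choose a : ℚ) / ((b+2) * (b+1)) := by
      field_simp; linear_combination p2
    have hne : (((2 * (J+a+1) + b : ℕ) : ℚ) - J + 1) = J + 2 * a + b + 3 := by push_cast; ring
    have hne2 : (((2 * (J+a+1) + b : ℕ) : ℚ) - 2 * ((J + a : ℕ):ℚ)) = b + 2 := by push_cast; ring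
    have q3 : (dd (2 * (J+a+1) + b) J : ℚ) = ((2 * (J+a+1) + b).choose J : ℚ) * (2 * a + b + 3) / (J + 2 * a + b + 3) := by
      rw [hne] at p3
      field_simp
      rw [p3]; push_cast; ring
    rw [hne, hne2, q1, q2, q3]
    push_cast
    generalize ((2 * (J+a+1) + b).choose J : ℚ) = v at *
    generalize ((a+b).choose a : ℚ) = p at *
    field_simp
    ring
  induction J with
  | zero =>
    rw [Finset.sum_range_one, key 0 (by omega)]; simp
  | succ J ih =>
    rw [Finset.sum_range_succ, ih (by omega), key (J+1) hJ]
    have hc := choose_step n J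
    have hn : (n:ℚ) - J ≠ 0 := by
      have : ((J:ℚ) + 1) ≤ n := by exact_mod_cast (by omega : J + 1 ≤ n)
      intro h; linarith
    have hn2 : (n:ℚ) - 2 * M ≠ 0 := by
      have : (2 * ((M:ℚ) + 1)) ≤ n := by exact_mod_cast h
      intro h; linarith
    have e : M + 1 - (J+1) = M - J := by omega
    rw [e]
    have hv : (n.choose J : ℚ) = (n.choose (J+1) : ℚ) * ((J+1:ℕ):ℚ) / ((n:ℚ) - (J+1:ℕ) + 1) := by
      have : (n:ℚ) - (J+1:ℕ) + 1 = n - J := by push_cast; ring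
      rw [this]; field_simp; push_cast; linear_combination -hc
    rw [← hv]; push_cast; ring

/-- the closed form of the one-norm -/
lemma norm_sum (n M : ℕ) (h : 2 * M ≤ n) :
    ∑ j ∈ Finset.range (M+1), (dd n j : ℚ) * ((n - M - j).choose (M - j) : ℚ)
      = 2 ^ M / (M.factorial : ℚ) * ∏ α ∈ Finset.Icc 1 M, ((n : ℚ) - 2 * (α : ℚ) + 1) := by
  induction M with
  | zero => simp [dd]
  | succ M ih =>
    have ih := ih (by omega)
    have ht := tele_partial n M M le_rfl h
    rw [Finset.sum_sub_distrib, ← Finset.mul_sum, ← Finset.mul_sum, ih] at ht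
    rw [Finset.sum_range_succ, Finset.prod_Icc_succ_top (by omega), Nat.factorial_succ]
    have hf := dd_formula n (M+1)
    have hc := choose_step n M
    have hn : (n:ℚ) - M ≠ 0 := by
      have : (2 * ((M:ℚ) + 1)) ≤ n := by exact_mod_cast h
      have : (0:ℚ) ≤ M := by positivity
      intro h; linarith
    have hn2 : (n:ℚ) - 2 * M ≠ 0 := by
      have : (2 * ((M:ℚ) + 1)) ≤ n := by exact_mod_cast h
      intro h; linarith
    have hd : (dd n (M+1) : ℚ) * (M+1) = (n.choose M : ℚ) * (n - 2 * M - 1) := by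
      simp only [dd]; push_cast; linear_combination hc
    simp only [Nat.sub_self, Nat.choose_zero_right, Nat.cast_one, mul_one] at ht ⊢
    have hm : (M:ℚ) + 1 ≠ 0 := by positivity
    have hr : (n.choose M : ℚ) * ((n:ℚ) - 2 * M) * ((n:ℚ) - M - 1 - M) / ((n:ℚ) - 2 * M)
        = (n.choose M : ℚ) * ((n:ℚ) - M - 1 - M) := by
      field_simp
    rw [hr] at ht
    push_cast
    have hF : (M.factorial : ℚ) ≠ 0 := by positivity
    set S := ∑ x ∈ Finset.range (M + 1), (dd n x : ℚ) * ((n - (M + 1) - x).choose (M + 1 - x) : ℚ)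
    set P := ∏ α ∈ Finset.Icc 1 M, ((n : ℚ) - 2 * (α : ℚ) + 1)
    field_simp at ht ⊢
    rw [pow_succ]
    linear_combination ht + (M.factorial : ℚ) * hd

lemma arith_one (M : ℕ) (h : 2 ≤ M) : 2 ^ M * (M+1) + 2 * (2 * M + 1) ≤ 2 * 4 ^ M := by
  induction M, h using Nat.le_induction with
  | base => norm_num
  | succ M h ih =>
    have h2 : 2 ^ M ≤ 2 ^ M * M := Nat.le_mul_of_pos_right _ (by omega)
    rw [pow_succ, pow_succ]
    nlinarith [Nat.zero_le (2 ^ M * M), Nat.zero_le (2 ^ M)]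

lemma arith_two (M : ℕ) (h : 3 ≤ M) : 2 * (M+1) * (M+3) ≤ 4 ^ M := by
  induction M, h using Nat.le_induction with
  | base => norm_num
  | succ M h ih =>
    rw [pow_succ]
    nlinarith

lemma prod_Icc_range (n M : ℕ) : ∏ α ∈ Finset.Icc 1 M, ((n : ℚ) - 2 * (α : ℚ) + 1)
    = ∏ i ∈ Finset.range M, ((n : ℚ) - 2 * (i : ℚ) - 1) := by
  induction M with
  | zero => simp
  | succ M ih =>
    rw [Finset.prod_Icc_succ_top (by omega), ih, Finset.prod_range_succ]
    congr 1; push_cast; ring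

lemma dd_lower (n M j : ℕ) (hM : 2 ≤ M) (hn : 4 ^ M ≤ n) (hj : M + 1 ≤ j) (hjn : 2 * j ≤ n) :
    2 ^ M / (M.factorial : ℚ) * ∏ α ∈ Finset.Icc 1 M, ((n : ℚ) - 2 * (α : ℚ) + 1)
      ≤ 2 * (dd n j : ℚ) := by
  rw [prod_Icc_range]
  have hF : (0:ℚ) < M.factorial := by positivity
  have hnM : (2 * (M:ℚ) + 2) ≤ n := by exact_mod_cast (by omega : 2 * M + 2 ≤ n)
  have hterm : ∀ i ∈ Finset.range M, (0:ℚ) ≤ (n : ℚ) - 2 * (i : ℚ) - 1 := by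
    intro i hi
    have : (i:ℚ) + 1 ≤ M := by exact_mod_cast Finset.mem_range.mp hi
    linarith
  have hn' : (4:ℚ) ^ M ≤ n := by exact_mod_cast hn
  rw [div_mul_eq_mul_div, div_le_iff₀ hF]
  rcases Nat.eq_or_lt_of_le hj with rfl | hj2
  · have h1 := dd_prod n M
    rw [Nat.factorial_succ] at h1
    push_cast at h1
    have h2 : ∏ i ∈ Finset.range M, ((n : ℚ) - 2 * (i : ℚ) - 1)
        ≤ ∏ i ∈ Finset.range M, ((n : ℚ) - i) := by
      apply Finset.prod_le_prod hterm
      intro i hi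
      have : (0:ℚ) ≤ i := by positivity
      linarith
    have h3 : (2:ℚ) ^ M * (M+1) + 2 * (2 * M + 1) ≤ 2 * 4 ^ M := by exact_mod_cast arith_one M hM
    have h0 := Finset.prod_nonneg hterm
    set P := ∏ i ∈ Finset.range M, ((n : ℚ) - 2 * (i : ℚ) - 1)
    set Q := ∏ i ∈ Finset.range M, ((n : ℚ) - i)
    have h4 : (2:ℚ) ^ M * (M+1) ≤ 2 * (n - 2 * M - 1) := by linarith
    have hM1 : (0:ℚ) < (M:ℚ) + 1 := by positivity
    refine le_of_mul_le_mul_right ?_ hM1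
    calc (2:ℚ)^M * P * (M+1) = (2^M * (M+1)) * P := by ring
      _ ≤ (2 * (n - 2 * M - 1)) * Q := by
        apply mul_le_mul h4 h2 h0; linarith
      _ = _ := by linear_combination -2 * h1
  · obtain ⟨i, rfl⟩ : ∃ i, j = M + 2 + i := ⟨j - (M+2), by omega⟩
    obtain ⟨g, rfl⟩ : ∃ g, n = (g + (M + 2)) + i := ⟨n - i - (M + 2), by omega⟩
    have hd := dd_diag (g + (M+2)) (M+2) i (by omega)
    have hd' : (dd (g + (M+2)) (M+2) : ℚ) ≤ (dd (g + (M+2) + i) (M+2+i) : ℚ) := by exact_mod_cast hd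
    have h2g : ((g + (M + 2) + i : ℕ) : ℚ) ≤ 2 * g := by exact_mod_cast (by omega)
    have h1 := dd_prod (g + (M+2)) (M+1)
    rw [Finset.prod_range_succ, Nat.factorial_succ, Nat.factorial_succ] at h1
    set N := g + (M + 2) + i with hN
    refine le_trans ?_ (mul_le_mul_of_nonneg_right (mul_le_mul_of_nonneg_left hd' (by norm_num)) hF.le)
    push_cast at h1
    set P := ∏ i ∈ Finset.range M, ((N : ℚ) - 2 * (i : ℚ) - 1)
    set Q := ∏ i ∈ Finset.range M, ((g : ℚ) + (M + 2) - i) with hQ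
    have hC : (0:ℚ) < ((M:ℚ) + 1) * (M + 2) := by positivity
    refine le_of_mul_le_mul_right ?_ hC
    have hgoal : 2 * (dd (g + (M+2)) (M+2) : ℚ) * M.factorial * (((M:ℚ) + 1) * (M + 2))
        = 2 * Q * ((g+2) * (g - M - 1)) := by
      linear_combination 2 * h1
    rw [hgoal]
    rcases Nat.eq_or_lt_of_le hM with rfl | hM3
    · have hP : P = (N - 1) * (N - 3) := by
        simp only [P, Finset.prod_range_succ, Finset.prod_range_zero]; push_cast; ring
      have hQ2 : Q = (g + 4) * (g + 3) := by
        simp only [Q, Finset.prod_range_succ, Finset.prod_range_zero]; push_cast; ring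
      rw [hP, hQ2]
      have hN16 : (16:ℚ) ≤ N := by norm_num at hn' ⊢; exact hn'
      have hg8 : (8:ℚ) ≤ g := by linarith
      have a1 : ((N:ℚ) - 1) * (N - 3) ≤ (2 * g - 1) * (2 * g - 3) := by
        apply mul_le_mul <;> linarith
      have a2 : 24 * ((2 * (g:ℚ) - 1) * (2 * g - 3)) ≤ (g+4) * (g+3) * ((g+2) * (g-3)) := by
        obtain ⟨e, he⟩ : ∃ e : ℚ, (g:ℚ) = e + 8 := ⟨g - 8, by ring⟩
        have he0 : 0 ≤ e := by linarith
        rw [he]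
        have : 0 ≤ e^2 := by positivity
        have : 0 ≤ e^3 := by positivity
        have : 0 ≤ e^4 := by positivity
        nlinarith
      push_cast
      linarith
    · have hPle : P ≤ (2 * g) ^ M := by
        have : P ≤ ∏ i ∈ Finset.range M, (2 * (g:ℚ)) := by
          apply Finset.prod_le_prod hterm
          intro i hi
          have : (0:ℚ) ≤ i := by positivity
          linarith
        simpa using this
      have hQge : (g:ℚ) ^ M ≤ Q := by
        have : ∏ i ∈ Finset.range M, (g:ℚ) ≤ Q := by
          apply Finset.prod_le_prod
          · intro i hi; positivity
          · intro i hi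
            have : (i:ℚ) + 1 ≤ M := by exact_mod_cast Finset.mem_range.mp hi
            linarith
        simpa using this
      have h5 : (2 * ((M:ℚ)+1) * (M+3)) ≤ 4 ^ M := by exact_mod_cast arith_two M hM3
      have h6 : ((M:ℚ)+1) * (M+2) ≤ g - M - 1 := by nlinarith
      have h7 : (4:ℚ)^M ≤ 2 * (g + 2) := by linarith
      have h8 : (4:ℚ)^M * (((M:ℚ)+1) * (M+2)) ≤ 2 * (g+2) * (g - M - 1) :=
        mul_le_mul h7 h6 hC.le (by positivity)
      have h9 : (2:ℚ)^M * (2 * g)^M = 4^M * g^M := by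
        rw [← mul_pow, ← mul_pow]; congr 1; ring
      have h10 : (0:ℚ) ≤ (g:ℚ)^M := by positivity
      calc (2:ℚ)^M * P * (((M:ℚ) + 1) * (M + 2))
          ≤ 2^M * (2 * g)^M * (((M:ℚ) + 1) * (M + 2)) := by gcongr
        _ = (4^M * (((M:ℚ)+1) * (M+2))) * g^M := by rw [h9]; ring
        _ ≤ (2 * (g+2) * (g - M - 1)) * Q := by
          apply mul_le_mul h8 hQge h10
          apply mul_nonneg (by positivity); linarith
        _ = _ := by ring

lemma zChoose_nat (a b : ℕ) : zChoose (a:ℤ) (b:ℤ) = (a.choose b : ℤ) := by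
  unfold zChoose
  split_ifs with h
  · simp
  · rw [Nat.choose_eq_zero_of_lt (by omega)]; simp

lemma zChoose_neg (a b : ℤ) (h : b < 0) : zChoose a b = 0 := by
  unfold zChoose
  rw [if_neg (by omega)]

lemma coeff_eq (n l j : ℕ) (h : 2 * l ≤ n) :
    zChoose ((n : ℤ) - 2 * (l : ℤ)) ((j : ℤ) - (l : ℤ)) -
        zChoose ((n : ℤ) - 2 * (l : ℤ)) ((j : ℤ) - (l : ℤ) - 1)
      = if l ≤ j then dd (n - 2 * l) (j - l) else 0 := by
  have e : (n:ℤ) - 2 * (l:ℤ) = ((n - 2 * l : ℕ) : ℤ) := by omega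
  rw [e]
  split_ifs with hl
  · obtain ⟨i, rfl⟩ : ∃ i, j = l + i := ⟨j - l, by omega⟩
    have e2 : ((l + i : ℕ) : ℤ) - l = (i : ℤ) := by push_cast; ring
    rw [e2, zChoose_nat, Nat.add_sub_cancel_left]
    cases i with
    | zero => rw [zChoose_neg _ _ (by simp)]; simp [dd]
    | succ i =>
      have e3 : ((i+1 : ℕ) : ℤ) - 1 = (i:ℤ) := by push_cast; ring
      rw [e3, zChoose_nat]; rfl
  · rw [zChoose_neg _ _ (by omega), zChoose_neg _ _ (by omega)]; simp

lemma sys_iff (n k t : ℕ) (x : ℕ → ℤ) (h : 2 * (k / 2) ≤ n) :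
    SU2System n k t x ↔
      (∑ j ∈ Finset.range (n / 2 + 1), dd n j * |x j| ≤ 2 * (t : ℤ)) ∧
      ∀ l ≤ k / 2, ∑ j ∈ Finset.range (n / 2 + 1),
        (if l ≤ j then dd (n - 2 * l) (j - l) else 0) * x j = 0 := by
  unfold SU2System
  have h0 : ∀ j : ℕ, zChoose (n : ℤ) (j : ℤ) - zChoose (n : ℤ) ((j : ℤ) - 1) = dd n j := by
    intro j
    have := coeff_eq n 0 j (by omega)
    simpa using this
  simp only [h0]
  refine and_congr Iff.rfl ?_
  constructor
  · intro H l hl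
    refine Eq.trans ?_ (H l (Finset.mem_range.mpr (by omega)))
    exact Finset.sum_congr rfl fun j _ => by rw [coeff_eq n l j (by omega)]
  · intro H l hl
    have hl := Finset.mem_range.mp hl
    rw [← H l (by omega)]
    exact Finset.sum_congr rfl fun j _ => by rw [coeff_eq n l j (by omega)]

/-- The minimal solution. -/
def xs (n M : ℕ) (j : ℕ) : ℤ :=
  if j ≤ M then (-1) ^ j * ((n - M - j).choose (M - j) : ℤ) else 0

lemma sum_trunc (n M : ℕ) (hM : 2 * M ≤ n) (f x : ℕ → ℤ)
    (hx : ∀ j ∈ Finset.range (n / 2 + 1), M < j → x j = 0) :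
    ∑ j ∈ Finset.range (n / 2 + 1), f j * x j = ∑ j ∈ Finset.range (M + 1), f j * x j := by
  symm
  apply Finset.sum_subset
  · intro j hj
    rw [Finset.mem_range] at *; omega
  · intro j hj hj2
    rw [Finset.mem_range] at hj2
    rw [hx j hj (by omega), mul_zero]

lemma xs_orth (n M l : ℕ) (hM : 2 * M ≤ n) (hl : l < M) :
    ∑ j ∈ Finset.range (M + 1), (if l ≤ j then dd (n - 2 * l) (j - l) else 0) * xs n M j = 0 := by
  obtain ⟨m, rfl⟩ : ∃ m, M = l + m := ⟨M - l, by omega⟩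
  rw [add_assoc, Finset.sum_range_add]
  rw [Finset.sum_eq_zero (s := Finset.range l), zero_add]
  · have := alt_sum (n - 2 * l) m (by omega) (by omega)
    rw [← mul_zero ((-1:ℤ)^l), ← this, Finset.mul_sum]
    apply Finset.sum_congr rfl
    intro i hi
    have hi := Finset.mem_range.mp hi
    rw [if_pos (by omega), xs, if_pos (by omega)]
    have e1 : n - (l + m) - (l + i) = n - 2 * l - m - i := by omega
    have e2 : l + m - (l + i) = m - i := by omega
    rw [e1, e2, Nat.add_sub_cancel_left, pow_add]; ring
  · intro j hj
    have hj := Finset.mem_range.mp hj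
    rw [if_neg (by omega), zero_mul]

lemma xs_norm (n M : ℕ) (hM : 2 * M ≤ n) :
    ((∑ j ∈ Finset.range (M + 1), dd n j * |xs n M j| : ℤ) : ℚ)
      = 2 ^ M / (M.factorial : ℚ) * ∏ α ∈ Finset.Icc 1 M, ((n : ℚ) - 2 * (α : ℚ) + 1) := by
  rw [← norm_sum n M hM]
  push_cast
  apply Finset.sum_congr rfl
  intro j hj
  have hj := Finset.mem_range.mp hj
  rw [xs, if_pos (by omega)]
  push_cast
  rw [abs_mul, abs_pow]; simp

lemma triangular (n M : ℕ) (y : ℕ → ℤ) (hyM : y M = 0)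
    (h : ∀ l < M, ∑ j ∈ Finset.range (M + 1),
      (if l ≤ j then dd (n - 2 * l) (j - l) else 0) * y j = 0) :
    ∀ i ≤ M, y (M - i) = 0 := by
  intro i
  induction i using Nat.strong_induction_on with
  | _ i ih =>
    intro hi
    rcases Nat.eq_zero_or_pos i with rfl | hpos
    · simpa using hyM
    have := h (M - i) (by omega)
    rw [Finset.sum_eq_single (M - i)] at this
    · simpa [dd] using this
    · intro j hj hne
      have hj := Finset.mem_range.mp hj
      split_ifs with hle
      · have := ih (M - j) (by omega) (by omega)
        rw [show M - (M - j) = j by omega] at this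
        rw [this, mul_zero]
      · simp
    · intro hn
      exact absurd (Finset.mem_range.mpr (by omega)) hn

/-- Theorem (SU(2), general locality, n ≥ 2^{2(⌊k/2⌋+1)}): the SU(2) system with
parameters `(n,k,t)` has no nontrivial integer solution iff `t < c(n,k)`. -/
theorem SU2_general_locality (n k t : ℕ) (hk : 2 ≤ k)
    (hn : 2 ^ (2 * (k / 2 + 1)) ≤ n) (ht : 0 < t) :
    (¬ ∃ x : ℕ → ℤ, SU2Nontrivial n x ∧ SU2System n k t x) ↔ (t : ℚ) < su2C n k := by
  obtain ⟨M, hM⟩ : ∃ M, M = k / 2 + 1 := ⟨_, rfl⟩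
  have hM2 : 2 ≤ M := by omega
  have hn4 : 4 ^ M ≤ n := by
    rw [← hM, pow_mul] at hn; simpa using hn
  have hnM : 2 * M + 2 ≤ n := by
    have := arith_one M hM2
    have : 2 * M + 2 * 1 ≤ 2 ^ M * (M+1) * 1 + 0 := by
      have : 4 ≤ 2 ^ M := by
        calc 4 = 2 ^ 2 := by norm_num
          _ ≤ 2 ^ M := Nat.pow_le_pow_right (by norm_num) hM2
      nlinarith
    omega
  have hC : 2 * su2C n k
      = 2 ^ M / (M.factorial : ℚ) * ∏ α ∈ Finset.Icc 1 M, ((n : ℚ) - 2 * (α : ℚ) + 1) := by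
    rw [su2C, ← hM, hM, pow_succ]; ring
  constructor
  · intro H
    by_contra hlt
    push Not at hlt
    apply H
    refine ⟨xs n M, ⟨M, Finset.mem_range.mpr (by omega), by simp [xs]⟩, ?_⟩
    rw [sys_iff _ _ _ _ (by omega)]
    have hz : ∀ j ∈ Finset.range (n / 2 + 1), M < j → xs n M j = 0 := by
      intro j _ hj; rw [xs, if_neg (by omega)]
    constructor
    · rw [sum_trunc n M (by omega) (dd n) (fun j => |xs n M j|)
        (fun j h1 h2 => by rw [hz j h1 h2, abs_zero])]
      have h1 := xs_norm n M (by omega)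
      rw [← hC] at h1
      have : ((∑ j ∈ Finset.range (M + 1), dd n j * |xs n M j| : ℤ) : ℚ) ≤ ((2 * (t:ℤ) : ℤ) : ℚ) := by
        rw [h1]; push_cast; linarith
      exact_mod_cast this
    · intro l hl
      rw [sum_trunc n M (by omega) _ _ hz]
      exact xs_orth n M l (by omega) (by omega)
  · rintro hlt ⟨x, ⟨j0, hj0, hx0⟩, hsys⟩
    rw [sys_iff _ _ _ _ (by omega)] at hsys
    obtain ⟨hA, hB⟩ := hsys
    have hA' : ((∑ j ∈ Finset.range (n / 2 + 1), dd n j * |x j| : ℤ) : ℚ) < 2 * su2C n k := by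
      have : ((∑ j ∈ Finset.range (n / 2 + 1), dd n j * |x j| : ℤ) : ℚ) ≤ ((2 * (t:ℤ) : ℤ) : ℚ) := by
        exact_mod_cast hA
      push_cast at this ⊢
      linarith
    rw [hC] at hA'
    by_cases hz : ∀ j ∈ Finset.range (n / 2 + 1), M < j → x j = 0
    · have hy := triangular n M (fun j => x j - ((-1)^M * x M) * xs n M j)
        (by
          have : ((-1:ℤ)^M * (-1)^M) = 1 := by rw [← mul_pow]; simp
          simp only [xs, le_refl, if_true, Nat.sub_self, Nat.choose_zero_right, Nat.cast_one, mul_one]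
          linear_combination (-x M) * this)
        (by
          intro l hl
          have h1 := hB l (by omega)
          rw [sum_trunc n M (by omega) _ _ hz] at h1
          have h2 := xs_orth n M l (by omega) hl
          simp only [mul_sub, Finset.sum_sub_distrib]
          rw [h1, zero_sub, neg_eq_zero]
          refine Eq.trans ?_ ((congrArg (fun z => ((-1)^M * x M) * z) h2).trans (mul_zero _))
          simp only [Finset.mul_sum]
          exact Finset.sum_congr rfl fun j _ => by ring)
      have hx : ∀ j ≤ M, x j = ((-1)^M * x M) * xs n M j := by
        intro j hj
        have := hy (M - j) (by omega)
        rw [show M - (M - j) = j by omega] at this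
        exact sub_eq_zero.mp this
      have hxM : x M ≠ 0 := by
        intro h0
        have hj0M : j0 ≤ M := by
          by_contra hc
          exact hx0 (hz j0 hj0 (by omega))
        apply hx0
        rw [hx j0 hj0M, h0]; simp
      have h1 : 1 ≤ |x M| := Int.one_le_abs hxM
      rw [sum_trunc n M (by omega) (dd n) (fun j => |x j|)
        (fun j h1 h2 => by simp only [hz j h1 h2, abs_zero]), ← xs_norm n M (by omega)] at hA'
      have hA2 : ∑ j ∈ Finset.range (M + 1), dd n j * |x j|
          < ∑ j ∈ Finset.range (M + 1), dd n j * |xs n M j| := by exact_mod_cast hA'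
      apply absurd hA2
      rw [not_lt]
      apply Finset.sum_le_sum
      intro j hj
      have hj := Finset.mem_range.mp hj
      apply mul_le_mul_of_nonneg_left _ (dd_nonneg n j (by omega))
      rw [hx j (by omega), abs_mul, abs_mul, abs_pow]
      simp only [abs_neg, abs_one, one_pow, one_mul]
      exact le_mul_of_one_le_left (abs_nonneg _) h1
    · push Not at hz
      obtain ⟨j, hj, hMj, hxj⟩ := hz
      have hjn := Finset.mem_range.mp hj
      have hlow := dd_lower n M j hM2 hn4 (by omega) (by omega)
      have hlt2 : ((∑ j ∈ Finset.range (n / 2 + 1), dd n j * |x j| : ℤ) : ℚ) < ((2 * dd n j : ℤ) : ℚ) := by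
        refine lt_of_lt_of_le hA' ?_
        push_cast; exact hlow
      have hlt3 : ∑ j ∈ Finset.range (n / 2 + 1), dd n j * |x j| < 2 * dd n j := by
        exact_mod_cast hlt2
      have h0 := hB 0 (by omega)
      simp only [Nat.zero_le, if_true, Nat.mul_zero, Nat.sub_zero] at h0
      have hd0 := dd_nonneg n j (by omega)
      rw [← Finset.add_sum_erase _ _ hj] at h0 hlt3
      have h1 : |dd n j * x j| ≤ ∑ i ∈ (Finset.range (n / 2 + 1)).erase j, dd n i * |x i| := by
        rw [eq_neg_of_add_eq_zero_left h0, abs_neg]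
        refine (Finset.abs_sum_le_sum_abs _ _).trans (Finset.sum_le_sum fun i hi => ?_)
        have hi := Finset.mem_range.mp (Finset.mem_of_mem_erase hi)
        rw [abs_mul, abs_of_nonneg (dd_nonneg n i (by omega))]
      rw [abs_mul, abs_of_nonneg hd0] at h1
      have h2 : dd n j * 1 ≤ dd n j * |x j| :=
        mul_le_mul_of_nonneg_left (Int.one_le_abs hxj) hd0
      linarith
end

section
/- Let n and k be integers with 0 ≤ k ≤ n−1, and define a_{n,k,j} := ∑_{p=0}^{j} C(n, j−p)·C(n−k+p−1, p) for j ≥ 0, where C(·,·) denotes the binomial coefficient. Then (a_{n,k,⌈k/2⌉} + a_{n,k,⌊k/2⌋}) / 2 = (2^{⌊k/2⌋}/⌈k/2⌉!)·∏_{α=1}^{⌈k/2⌉}(n−k+2α−1), as an identity of rational numbers. -/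
/-- `a(n,k,j) = ∑_{p=0}^{j} C(n, j−p)·C(n−k+p−1, p)`. -/
def aSeq (n k j : ℕ) : ℕ :=
  ∑ p ∈ Finset.range (j + 1), n.choose (j - p) * (n - k + p - 1).choose p

open PowerSeries in
/-- The generating function `(1+X)^N (1-X)^{-(d+1)}`. -/
noncomputable def genF (d N : ℕ) : PowerSeries ℚ :=
  (1 + X) ^ N * PowerSeries.mk (fun p => ((d + p).choose d : ℚ))

open PowerSeries in
theorem genF_mul (d N : ℕ) : genF d N * (1 - X) ^ (d + 1) = (1 + X) ^ N := by
  unfold genF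
  rw [mul_assoc, PowerSeries.mk_add_choose_mul_one_sub_pow_eq_one, mul_one]

open PowerSeries in
theorem genF_ode (d N : ℕ) : PowerSeries.derivative ℚ (genF d (N + 1)) * (1 - X ^ 2) =
    ((d : PowerSeries ℚ) + 1) * genF d (N + 1) * (1 + X)
      + ((N : PowerSeries ℚ) + 1) * genF d (N + 1) * (1 - X) := by
  have h := genF_mul d (N + 1)
  have h2 := congrArg (PowerSeries.derivative ℚ) h
  have hx : ((1 : PowerSeries ℚ) - X) ^ (d + 1) ≠ 0 := by
    apply pow_ne_zero
    intro h0
    have := congrArg PowerSeries.constantCoeff h0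
    simp at this
  simp only [Derivation.leibniz, Derivation.leibniz_pow, map_sub, map_add, smul_eq_mul,
    Derivation.map_one_eq_zero, PowerSeries.derivative_X, nsmul_eq_mul, Nat.add_sub_cancel,
    Nat.cast_add, Nat.cast_one] at h2
  apply mul_right_cancel₀ hx
  generalize PowerSeries.derivative ℚ (genF d (N + 1)) = F' at *
  generalize genF d (N + 1) = F at *
  linear_combination (1 - X ^ 2) * h2 - ((N : PowerSeries ℚ) + 1) * (1 - X) * h

open PowerSeries in
theorem genF_coeff (d k j : ℕ) :
    PowerSeries.coeff j (genF d (d + 1 + k)) = (aSeq (d + 1 + k) k j : ℚ) := by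
  unfold genF aSeq
  rw [mul_comm, PowerSeries.coeff_mul, Finset.Nat.sum_antidiagonal_eq_sum_range_succ_mk]
  push_cast
  apply Finset.sum_congr rfl
  intro p _
  have e : d + 1 + k - k + p - 1 = d + p := by omega
  rw [e, add_comm (1 : PowerSeries ℚ) X, PowerSeries.coeff_mk]
  have : ((X : PowerSeries ℚ) + 1) ^ (d + 1 + k)
      = (((Polynomial.X + 1) ^ (d + 1 + k) : Polynomial ℚ) : PowerSeries ℚ) := by simp
  rw [this, Polynomial.coeff_coe, Polynomial.coeff_X_add_one_pow, mul_comm,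
    Nat.choose_symm_add]

open PowerSeries in
theorem genF_succ (d N : ℕ) : genF d (N + 1) = genF d N + genF d N * X := by
  unfold genF; ring

open PowerSeries in
theorem genF_step (d s : ℕ) :
    ((s : ℚ) + 1) * PowerSeries.coeff (s + 1) (genF d (d + 1 + 2 * (s + 1)))
      = 2 * ((d : ℚ) + 1 + 2 * s + 1) * PowerSeries.coeff s (genF d (d + 1 + 2 * s)) := by
  have h := genF_ode d (d + 2 * s)
  have e1 : d + 1 + 2 * (s + 1) = d + 2 * s + 1 + 1 + 1 := by ring
  have e2 : d + 1 + 2 * s = d + 2 * s + 1 := by ring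
  rw [e1, e2, genF_succ, genF_succ]
  generalize genF d (d + 2 * s + 1) = F at *
  have h' : PowerSeries.derivative ℚ F - PowerSeries.derivative ℚ F * X * X
      = C ((d : ℚ) + 1) * (F + F * X) + C ((d : ℚ) + 2 * s + 1) * (F - F * X) := by
    simp only [map_add, map_mul, map_natCast, map_one, map_ofNat]
    push_cast at h
    linear_combination h
  have hcoef : ∀ (a b : ℚ), PowerSeries.derivative ℚ F - PowerSeries.derivative ℚ F * X * X
      = C a * (F + F * X) + C b * (F - F * X) →
      PowerSeries.coeff s (PowerSeries.derivative ℚ F)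
        - PowerSeries.coeff s (PowerSeries.derivative ℚ F * X * X)
      = a * (PowerSeries.coeff s F + PowerSeries.coeff s (F * X))
        + b * (PowerSeries.coeff s F - PowerSeries.coeff s (F * X)) := by
    intro a b hab
    have := congrArg (PowerSeries.coeff s) hab
    simpa only [map_add, map_sub, PowerSeries.coeff_C_mul] using this
  have hc := hcoef _ _ h'
  clear h' hcoef h
  rcases s with _ | _ | s
  · simp only [map_add, PowerSeries.coeff_derivative, PowerSeries.coeff_succ_mul_X,
      PowerSeries.coeff_zero_mul_X, add_mul] at hc ⊢
    push_cast at hc ⊢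
    linear_combination hc
  · simp only [map_add, PowerSeries.coeff_derivative, PowerSeries.coeff_succ_mul_X,
      PowerSeries.coeff_zero_mul_X, add_mul] at hc ⊢
    push_cast at hc ⊢
    linear_combination hc
  · simp only [map_add, PowerSeries.coeff_derivative, PowerSeries.coeff_succ_mul_X] at hc ⊢
    push_cast at hc ⊢
    linear_combination hc

theorem genF_main (d s : ℕ) :
    PowerSeries.coeff s (genF d (d + 1 + 2 * s)) = (2 ^ s / (Nat.factorial s : ℚ)) *
        ∏ α ∈ Finset.Icc 1 s, ((d : ℚ) + 1 + 2 * (α : ℚ) - 1) := by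
  induction s with
  | zero => simp [genF]
  | succ s ih =>
    have h := genF_step d s
    rw [ih] at h
    have hs : (s : ℚ) + 1 ≠ 0 := by positivity
    have hf : (Nat.factorial s : ℚ) ≠ 0 := by positivity
    apply mul_left_cancel₀ hs
    rw [h, Finset.prod_Icc_succ_top (by omega), Nat.factorial_succ]
    push_cast
    field_simp
    ring

/-- Lemma (sequence_property2):
`(a_{n,k,⌈k/2⌉} + a_{n,k,⌊k/2⌋})/2 = (2^⌊k/2⌋/⌈k/2⌉!)·∏_{α=1}^{⌈k/2⌉}(n−k+2α−1)`. -/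
theorem sequence_property2 (n k : ℕ) (hkn : k + 1 ≤ n) :
    ((aSeq n k ((k + 1) / 2) : ℚ) + (aSeq n k (k / 2) : ℚ)) / 2 =
      (2 ^ (k / 2) / (Nat.factorial ((k + 1) / 2) : ℚ)) *
        ∏ α ∈ Finset.Icc 1 ((k + 1) / 2), ((n : ℚ) - (k : ℚ) + 2 * (α : ℚ) - 1) := by
  obtain ⟨d, rfl⟩ : ∃ d, n = d + 1 + k := ⟨n - 1 - k, by omega⟩
  have e0 : ((d + 1 + k : ℕ) : ℚ) - (k : ℚ) = (d : ℚ) + 1 := by push_cast; ring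
  rw [e0, ← genF_coeff, ← genF_coeff]
  rcases Nat.even_or_odd' k with ⟨s, rfl | rfl⟩
  · have e1 : (2 * s + 1) / 2 = s := by omega
    have e2 : 2 * s / 2 = s := by omega
    rw [e1, e2, ← genF_main]
    ring
  · have e1 : (2 * s + 1 + 1) / 2 = s + 1 := by omega
    have e2 : (2 * s + 1) / 2 = s := by omega
    have h := genF_main d (s + 1)
    have e3 : d + 1 + 2 * (s + 1) = d + 1 + (2 * s + 1) + 1 := by ring
    rw [e3, genF_succ, map_add, PowerSeries.coeff_succ_mul_X] at h
    rw [e1, e2, h]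
    ring
end

section
/- Let n and k be natural numbers with n ≥ k. Then for every j ∈ {0, 1, …, ⌊k/2⌋} there exist real numbers v_0, v_1, …, v_{⌊k/2⌋} such that for every integer α: C(n−k, α−j) + C(n−k, α−k+j) = ∑_{l=0}^{⌊k/2⌋} v_l · C(n−2l, α−l). -/
/-- Extended binomial coefficient: `C(m,r)` for `0 ≤ r ≤ m`, else `0`. -/
def nzChoose (m : ℕ) (r : ℤ) : ℤ :=
  if 0 ≤ r ∧ r ≤ (m : ℤ) then (m.choose r.toNat : ℤ) else 0

theorem nzChoose_eq_nat (m r : ℕ) : nzChoose m (r : ℤ) = (m.choose r : ℤ) := by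
  unfold nzChoose
  split_ifs with h
  · simp
  · rw [Nat.choose_eq_zero_of_lt (by omega)]; simp

theorem nzChoose_neg (m : ℕ) (r : ℤ) (hr : r < 0) : nzChoose m r = 0 := by
  unfold nzChoose
  rw [if_neg (by omega)]

theorem nzChoose_pascal (m : ℕ) (r : ℤ) :
    nzChoose (m + 1) r = nzChoose m r + nzChoose m (r - 1) := by
  rcases lt_or_ge r 0 with h | h
  · rw [nzChoose_neg _ _ h, nzChoose_neg _ _ h, nzChoose_neg _ _ (by omega)]; simp
  · lift r to ℕ using h
    cases r with
    | zero =>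
      rw [nzChoose_eq_nat, nzChoose_eq_nat, nzChoose_neg _ _ (by simp)]; simp
    | succ r =>
      have e : ((r + 1 : ℕ) : ℤ) - 1 = (r : ℤ) := by push_cast; ring
      rw [e, nzChoose_eq_nat, nzChoose_eq_nat, nzChoose_eq_nat, Nat.choose_succ_succ']
      push_cast; ring

/-- A multiple of a single column is generated by the columns. -/
theorem column_single (n K j : ℕ) (hj : j ≤ K) (c : ℝ) (α : ℤ) :
    ∑ l ∈ Finset.range (K + 1),
      (if l = j then c else 0) * (nzChoose (n - 2 * l) (α - (l : ℤ)) : ℝ)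
      = c * (nzChoose (n - 2 * j) (α - (j : ℤ)) : ℝ) := by
  rw [Finset.sum_eq_single j]
  · simp
  · intro b _ hb; simp [hb]
  · intro h; exact absurd (Finset.mem_range.mpr (by omega)) h

theorem columns_generate (n K : ℕ) : ∀ m j N : ℕ, N + m + 2 * j = n → j + m / 2 ≤ K →
    ∃ v : ℕ → ℝ, ∀ α : ℤ,
      ((nzChoose N (α - (j : ℤ)) : ℝ) + (nzChoose N (α - (j : ℤ) - (m : ℤ)) : ℝ)) =
        ∑ l ∈ Finset.range (K + 1), v l * (nzChoose (n - 2 * l) (α - (l : ℤ)) : ℝ) := by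
  intro m
  induction m using Nat.strong_induction_on with
  | _ m ih =>
    intro j N hn hK
    match m, ih, hn, hK with
    | 0, _, hn, hK =>
      refine ⟨fun l => if l = j then 2 else 0, fun α => ?_⟩
      rw [column_single n K j (by omega), show n - 2 * j = N by omega]
      simp; ring
    | 1, _, hn, hK =>
      refine ⟨fun l => if l = j then 1 else 0, fun α => ?_⟩
      rw [column_single n K j (by omega), show n - 2 * j = N + 1 by omega, nzChoose_pascal]
      push_cast; ring
    | m + 2, ih, hn, hK =>
      obtain ⟨v, hv⟩ := ih (m + 1) (by omega) j (N + 1) (by omega) (by omega)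
      obtain ⟨w, hw⟩ := ih m (by omega) (j + 1) N (by omega) (by omega)
      refine ⟨fun l => v l - w l, fun α => ?_⟩
      simp only [sub_mul, Finset.sum_sub_distrib]
      rw [← hv, ← hw, nzChoose_pascal, nzChoose_pascal]
      have e1 : α - ((j + 1 : ℕ) : ℤ) = α - j - 1 := by push_cast; ring
      have e2 : α - (j : ℤ) - 1 - (m : ℤ) = α - j - ((m + 1 : ℕ) : ℤ) := by push_cast; ring
      have e3 : α - (j : ℤ) - ((m + 1 : ℕ) : ℤ) - 1 = α - j - ((m + 2 : ℕ) : ℤ) := by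
        push_cast; ring
      rw [e1, e2, e3]
      push_cast; ring

/-- Lemma (SU2_coefficient1): the shifted binomial columns `C(n−2l, ·−l)`
linearly generate the symmetrized columns `C(n−k, ·−j) + C(n−k, ·−k+j)`. -/
theorem SU2_coefficient1 (n k : ℕ) (hkn : k ≤ n) :
    ∀ j : ℕ, j ≤ k / 2 →
      ∃ v : ℕ → ℝ, ∀ α : ℤ,
        ((nzChoose (n - k) (α - (j : ℤ)) : ℝ) +
            (nzChoose (n - k) (α - (k : ℤ) + (j : ℤ)) : ℝ)) =
          ∑ l ∈ Finset.range (k / 2 + 1),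
            v l * (nzChoose (n - 2 * l) (α - (l : ℤ)) : ℝ) := by
  intro j hj
  obtain ⟨v, hv⟩ := columns_generate n (k / 2) (k - 2 * j) j (n - k) (by omega) (by omega)
  refine ⟨v, fun α => ?_⟩
  rw [← hv α, show α - (j : ℤ) - ((k - 2 * j : ℕ) : ℤ) = α - (k : ℤ) + (j : ℤ) by omega]
end

section
/- Let n and k be natural numbers with n ≥ k. Then for every j ∈ {0, 1, …, ⌊k/2⌋} there exist real numbers w_0, w_1, …, w_{⌊k/2⌋} such that for every integer α: C(n−2j, α−j) = ∑_{l=0}^{⌊k/2⌋} w_l · ( C(n−2l, α) + C(n−2l, α−2l) ). -/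
open Polynomial in
noncomputable def suQ (l : ℕ) : Submodule ℝ ℝ[X] :=
  Submodule.span ℝ ((fun i : ℕ => (X : ℝ[X]) ^ i * (1 + X) ^ (2 * (l - i))) '' Set.Iio l)

open Polynomial in
theorem suQ_mul {l : ℕ} (S : Submodule ℝ ℝ[X]) (r : ℝ[X])
    (h : ∀ i < l, r * ((X : ℝ[X]) ^ i * (1 + X) ^ (2 * (l - i))) ∈ S)
    {p : ℝ[X]} (hp : p ∈ suQ l) : r * p ∈ S := by
  have : suQ l ≤ S.comap (LinearMap.mulLeft ℝ r) := by
    unfold suQ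
    rw [Submodule.span_le]
    rintro _ ⟨i, hi, rfl⟩
    exact h i hi
  exact this hp

open Polynomial in
theorem suQ_basis {l i : ℕ} (hi : i < l) :
    (X : ℝ[X]) ^ i * (1 + X) ^ (2 * (l - i)) ∈ suQ l :=
  Submodule.subset_span ⟨i, hi, rfl⟩

open Polynomial in
theorem suQ_X {l : ℕ} {p : ℝ[X]} (hp : p ∈ suQ l) : X * p ∈ suQ (l + 1) := by
  refine suQ_mul _ _ (fun i hi => ?_) hp
  have := suQ_basis (l := l + 1) (i := i + 1) (by omega)
  rw [show l + 1 - (i + 1) = l - i by omega] at this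
  convert this using 1
  ring

open Polynomial in
theorem suQ_s {l : ℕ} {p : ℝ[X]} (hp : p ∈ suQ l) : (1 + X) ^ 2 * p ∈ suQ (l + 1) := by
  refine suQ_mul _ _ (fun i hi => ?_) hp
  have := suQ_basis (l := l + 1) (i := i) (by omega)
  rw [show l + 1 - i = l - i + 1 by omega] at this
  convert this using 1
  ring

open Polynomial in
theorem suQ_main (l : ℕ) : (1 + X ^ (2 * l) - C (2 * (-1) ^ l) * X ^ l : ℝ[X]) ∈ suQ l := by
  induction l using Nat.twoStepInduction with
  | zero =>
    convert Submodule.zero_mem _ using 1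
    simp only [mul_zero, pow_zero, mul_one, map_ofNat]
    norm_num
  | one =>
    have := suQ_basis (l := 1) (i := 0) (by omega)
    convert this using 1
    simp only [map_mul, map_pow, map_neg, map_one, map_ofNat]
    norm_num
    ring
  | more l h0 h1 =>
    have hb := suQ_basis (l := l + 2) (i := l + 1) (by omega)
    rw [show l + 2 - (l + 1) = 1 by omega] at hb
    have e1 := suQ_s h1
    have e2 := Submodule.smul_mem _ (-2 : ℝ) (suQ_X h1)
    have e3 := Submodule.smul_mem _ (-1 : ℝ) (suQ_X (suQ_X h0))
    have e4 := Submodule.smul_mem _ (2 * (-1) ^ (l + 1) : ℝ) hb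
    have := Submodule.add_mem _ (Submodule.add_mem _ (Submodule.add_mem _ e1 e2) e3) e4
    convert this using 1
    simp only [smul_eq_C_mul, map_mul, map_pow, map_neg, map_one, map_ofNat]
    ring

open Polynomial in
theorem su_span (n m : ℕ) (hm : 2 * m ≤ n) (j : ℕ) (hj : j ≤ m) :
    (X : ℝ[X]) ^ j * (1 + X) ^ (n - 2 * j) ∈ Submodule.span ℝ
      ((fun l : ℕ => (1 + X : ℝ[X]) ^ (n - 2 * l) * (1 + X ^ (2 * l))) ''
        (Finset.range (m + 1) : Set ℕ)) := by
  induction j using Nat.strong_induction_on with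
  | _ j ih =>
    set S := Submodule.span ℝ
      ((fun l : ℕ => (1 + X : ℝ[X]) ^ (n - 2 * l) * (1 + X ^ (2 * l))) ''
        (Finset.range (m + 1) : Set ℕ)) with hS
    have hB : (1 + X : ℝ[X]) ^ (n - 2 * j) * (1 + X ^ (2 * j)) ∈ S :=
      Submodule.subset_span ⟨j, by simp; omega, rfl⟩
    have h := suQ_mul S ((1 + X) ^ (n - 2 * j)) (fun i hi => by
      have := ih i hi (by omega)
      rw [show n - 2 * i = (n - 2 * j) + 2 * (j - i) by omega, pow_add] at this
      convert this using 1
      ring) (suQ_main j)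
    have h2 := Submodule.smul_mem _ ((-1) ^ j / 2 : ℝ) (Submodule.sub_mem _ hB h)
    convert h2 using 1
    have hc : (C ((-1) ^ j / 2 : ℝ) * C (2 * (-1) ^ j) : ℝ[X]) = 1 := by
      rw [← C_mul, show ((-1) ^ j / 2 : ℝ) * (2 * (-1) ^ j) = ((-1) * (-1)) ^ j by
        rw [mul_pow]; ring]
      simp
    rw [smul_eq_C_mul]
    linear_combination (-(X : ℝ[X]) ^ j * (1 + X) ^ (n - 2 * j)) * hc

open Polynomial in
theorem su_coeff (m d a : ℕ) :
    (nzChoose m ((a : ℤ) - (d : ℤ)) : ℝ) = ((X : ℝ[X]) ^ d * (1 + X) ^ m).coeff a := by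
  rw [coeff_X_pow_mul', nzChoose]
  by_cases h : d ≤ a
  · obtain ⟨b, rfl⟩ := Nat.exists_eq_add_of_le h
    have : ((d + b : ℕ) : ℤ) - (d : ℤ) = (b : ℤ) := by push_cast; ring
    rw [this, if_pos h, coeff_one_add_X_pow]
    simp only [Nat.add_sub_cancel_left, Int.toNat_natCast]
    split_ifs with h2
    · simp
    · rw [Nat.choose_eq_zero_of_lt (by omega)]; simp
  · rw [if_neg h, if_neg (by omega)]; simp

theorem su_neg (m : ℕ) (r : ℤ) (h : r < 0) : nzChoose m r = 0 := by
  rw [nzChoose, if_neg (by omega)]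

/-- Lemma (SU2_coefficient2): the symmetrized columns `C(n−2l, ·) + C(n−2l, ·−2l)`
linearly generate the shifted columns `C(n−2j, ·−j)`. -/
theorem SU2_coefficient2 (n k : ℕ) (hkn : k ≤ n) :
    ∀ j : ℕ, j ≤ k / 2 →
      ∃ w : ℕ → ℝ, ∀ α : ℤ,
        (nzChoose (n - 2 * j) (α - (j : ℤ)) : ℝ) =
          ∑ l ∈ Finset.range (k / 2 + 1),
            w l * ((nzChoose (n - 2 * l) α : ℝ) +
              (nzChoose (n - 2 * l) (α - 2 * (l : ℤ)) : ℝ)) := by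
  intro j hj
  have h := su_span n (k / 2) (by omega) j hj
  rw [Submodule.mem_span_image_finset_iff_exists_fun] at h
  obtain ⟨w', hw'⟩ := h
  obtain ⟨w, hw⟩ : ∃ w : ℕ → ℝ, ∑ l ∈ Finset.range (k / 2 + 1),
      w l • ((1 + Polynomial.X : Polynomial ℝ) ^ (n - 2 * l) * (1 + Polynomial.X ^ (2 * l))) =
        Polynomial.X ^ j * (1 + Polynomial.X) ^ (n - 2 * j) := by
    refine ⟨fun l => if h : l ∈ Finset.range (k / 2 + 1) then w' ⟨l, h⟩ else 0, ?_⟩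
    rw [← hw', ← Finset.sum_coe_sort]
    refine Finset.sum_congr rfl fun l _ => ?_
    simp only [dif_pos l.2]
  refine ⟨w, fun α => ?_⟩
  rcases lt_or_ge α 0 with hα | hα
  · rw [su_neg _ _ (by omega)]
    symm
    rw [Int.cast_zero]
    refine Finset.sum_eq_zero fun l _ => ?_
    rw [su_neg _ _ hα, su_neg _ _ (by omega)]
    simp
  · lift α to ℕ using hα
    rw [su_coeff, ← hw, Polynomial.finsetSum_coeff]
    refine Finset.sum_congr rfl fun l _ => ?_
    have h1 := su_coeff (n - 2 * l) 0 α
    have h2 := su_coeff (n - 2 * l) (2 * l) α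
    push_cast at h1 h2
    rw [sub_zero] at h1
    rw [h1, h2, Polynomial.coeff_smul, smul_eq_mul, ← Polynomial.coeff_add]
    congr 2
    ring
end

section
/- Let n, L be natural numbers and p_1, …, p_L integers with p_l ≥ 2 for every l and p_1 + ⋯ + p_L ≤ n. Let σ be a permutation of {1, …, n} that is the product of L disjoint cycles σ_1, …, σ_L, where σ_l is a cycle of length p_l, and σ fixes every point outside the supports of these cycles. Then for every integer w, the number of functions a : {1,…,n} → {0,1} satisfying a(σ(i)) = a(i) for all i and #{i : a(i) = 1} = w equals ∑_{(q_1,…,q_L) ∈ {0,1}^L} C( n − ∑_{l=1}^{L} p_l , w − ∑_{l=1}^{L} q_l·p_l ), where C(m,r) = 0 unless 0 ≤ r ≤ m. -/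
/-- Lemma (permutation_weight): counting σ-invariant binary strings of weight `w`,
for σ a product of `L` disjoint cycles of lengths `p_1,…,p_L`. -/
theorem permutation_weight (n L : ℕ) (p : Fin L → ℕ) (hp : ∀ l, 2 ≤ p l)
    (hsum : ∑ l, p l ≤ n) (σ : Equiv.Perm (Fin n))
    (σs : Fin L → Equiv.Perm (Fin n))
    (hcyc : ∀ l, (σs l).IsCycle)
    (hlen : ∀ l, (σs l).support.card = p l)
    (hdisj : ∀ l l', l ≠ l' → (σs l).Disjoint (σs l'))
    (hσ : σ = (List.ofFn σs).prod) (w : ℤ) :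
    (Nat.card {a : Fin n → Bool //
        (∀ i, a (σ i) = a i) ∧
        ((Finset.univ.filter fun i => a i = true).card : ℤ) = w} : ℤ) =
      ∑ q : Fin L → Bool,
        nzChoose (n - ∑ l, p l) (w - ∑ l, if q l then (p l : ℤ) else 0) := by
  classical
  have hpw : (List.ofFn σs).Pairwise Equiv.Perm.Disjoint := by
    rw [List.pairwise_ofFn]
    intro i j hij
    exact hdisj i j hij.ne
  have hσon : ∀ l, ∀ i ∈ (σs l).support, σ i = σs l i := by
    intro l i hi
    rw [hσ]
    exact (Equiv.Perm.eq_on_support_mem_disjoint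
      (List.mem_ofFn.mpr ⟨l, rfl⟩) hpw i hi).symm
  have hσoff : ∀ i, (∀ l, i ∉ (σs l).support) → σ i = i := by
    intro i hi
    by_contra hne
    have hm : i ∈ (List.ofFn σs).prod.support := by
      rw [← hσ]; exact Equiv.Perm.mem_support.mpr hne
    obtain ⟨f, hf, hif⟩ := Equiv.Perm.exists_mem_support_of_mem_support_prod hm
    obtain ⟨l, rfl⟩ := List.mem_ofFn.mp hf
    exact hi l hif
  have hx : ∀ l, ∃ x, x ∈ (σs l).support := by
    intro l
    have h1 : 0 < (σs l).support.card := by rw [hlen]; have := hp l; omega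
    exact Finset.card_pos.mp h1
  choose x hx using hx
  have hsd : ∀ l l', l ≠ l' → Disjoint (σs l).support (σs l').support := fun l l' h =>
    Equiv.Perm.disjoint_iff_disjoint_support.mp (hdisj l l' h)
  have huniq : ∀ l l' i, i ∈ (σs l).support → i ∈ (σs l').support → l = l' := by
    intro l l' i h h'
    by_contra hne
    exact Finset.disjoint_left.mp (hsd l l' hne) h h'
  have hinv : ∀ a : Fin n → Bool, (∀ i, a (σ i) = a i) ↔
      ∀ l, ∀ i ∈ (σs l).support, a i = a (x l) := by
    intro a
    constructor
    · intro h l i hi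
      have h1 : ∀ j, a (σs l j) = a j := by
        intro j
        by_cases hj : j ∈ (σs l).support
        · rw [← hσon l j hj]; exact h j
        · rw [Equiv.Perm.notMem_support.mp hj]
      have h2 : ∀ k : ℕ, ∀ j, a (((σs l) ^ k) j) = a j := by
        intro k
        induction k with
        | zero => intro j; simp
        | succ k ih => intro j; rw [pow_succ', Equiv.Perm.mul_apply, h1, ih]
      obtain ⟨k, hk⟩ := (hcyc l).exists_pow_eq (Equiv.Perm.mem_support.mp (hx l))
        (Equiv.Perm.mem_support.mp hi)
      rw [← hk, h2]
    · intro h i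
      by_cases hi : ∃ l, i ∈ (σs l).support
      · obtain ⟨l, hl⟩ := hi
        rw [hσon l i hl, h l i hl, h l _ (Equiv.Perm.apply_mem_support.mpr hl)]
      · push Not at hi
        rw [hσoff i hi]
  set U : Finset (Fin n) := Finset.univ.biUnion fun l => (σs l).support with hU
  have hpd : ((Finset.univ : Finset (Fin L)) : Set (Fin L)).PairwiseDisjoint
      (fun l => (σs l).support) := fun l _ l' _ h => hsd l l' h
  have hUcard : U.card = ∑ l, p l := by
    rw [hU, Finset.card_biUnion hpd]
    exact Finset.sum_congr rfl fun l _ => hlen l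
  have hFcard : Uᶜ.card = n - ∑ l, p l := by
    rw [Finset.card_compl, hUcard, Fintype.card_fin]
  have hmemU : ∀ i, i ∈ U ↔ ∃ l, i ∈ (σs l).support := by intro i; simp [hU]
  have hwt : ∀ a : Fin n → Bool, (∀ l, ∀ i ∈ (σs l).support, a i = a (x l)) →
      ((Finset.univ.filter fun i => a i = true).card : ℤ) =
        ((Uᶜ.filter fun i => a i = true).card : ℤ) +
          ∑ l, if a (x l) then (p l : ℤ) else 0 := by
    intro a ha
    rw [Finset.card_filter, Finset.card_filter, ← Finset.sum_compl_add_sum U]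
    push_cast
    congr 1
    rw [hU, Finset.sum_biUnion hpd]
    refine Finset.sum_congr rfl fun l _ => ?_
    rw [Finset.sum_congr rfl (g := fun _ => if a (x l) = true then (1 : ℤ) else 0)
      (fun i hi => by rw [ha l i hi]), Finset.sum_const, hlen l]
    split_ifs <;> simp
  rw [Nat.card_eq_fintype_card, Fintype.card_subtype,
    Finset.card_eq_sum_card_fiberwise (f := fun a l => a (x l)) (t := Finset.univ)
      (fun _ _ => Finset.mem_coe.mpr (Finset.mem_univ _))]
  push_cast
  refine Finset.sum_congr rfl fun q _ => ?_
  set r : ℤ := w - ∑ l, if q l then (p l : ℤ) else 0 with hr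
  have hmem : ∀ a : Fin n → Bool, a ∈ ((Finset.univ.filter fun a : Fin n → Bool =>
      (∀ i, a (σ i) = a i) ∧ ((Finset.univ.filter fun i => a i = true).card : ℤ) = w).filter
        fun a => (fun l => a (x l)) = q) ↔
      (∀ l, ∀ i ∈ (σs l).support, a i = q l) ∧
        ((Uᶜ.filter fun i => a i = true).card : ℤ) = r := by
    intro a
    simp only [Finset.mem_filter, Finset.mem_univ, true_and]
    constructor
    · rintro ⟨⟨h1, h2⟩, h3⟩
      have h4 := (hinv a).mp h1
      have h5 := hwt a h4
      subst h3
      exact ⟨h4, by rw [hr]; linarith⟩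
    · rintro ⟨h1, h2⟩
      have h3 : (fun l => a (x l)) = q := funext fun l => h1 l _ (hx l)
      have h4 : ∀ l, ∀ i ∈ (σs l).support, a i = a (x l) := by
        intro l i hi; rw [h1 l i hi, h1 l _ (hx l)]
      have h5 := hwt a h4
      refine ⟨⟨(hinv a).mpr h4, ?_⟩, h3⟩
      subst h3
      rw [hr] at h2
      linarith
  unfold nzChoose
  split_ifs with hcond
  · rw [← hFcard, ← Finset.card_powersetCard]
    congr 1
    refine Finset.card_bij' (fun a _ => Uᶜ.filter fun i => a i = true)
      (fun s _ i => if i ∈ U then decide (∃ l, i ∈ (σs l).support ∧ q l = true)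
        else decide (i ∈ s)) ?_ ?_ ?_ ?_
    · intro a ha
      have h := ((hmem a).mp ha).2
      rw [Finset.mem_powersetCard]
      exact ⟨Finset.filter_subset _ _, by omega⟩
    · intro s hs
      rw [Finset.mem_powersetCard] at hs
      rw [hmem]
      refine ⟨?_, ?_⟩
      · intro l i hi
        rw [if_pos ((hmemU i).mpr ⟨l, hi⟩), Bool.eq_iff_iff, decide_eq_true_iff]
        constructor
        · rintro ⟨l', h, h'⟩
          rwa [huniq l l' i hi h]
        · intro h
          exact ⟨l, hi, h⟩
      · have : (Uᶜ.filter fun i => (if i ∈ U then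
            decide (∃ l, i ∈ (σs l).support ∧ q l = true) else decide (i ∈ s)) = true) = s := by
          ext i
          have := @hs.1 i
          simp only [Finset.mem_compl, Finset.mem_filter] at this ⊢
          by_cases hi : i ∈ U
          · have h0 : i ∉ s := fun h => this h hi
            simp only [hi, h0, not_true_eq_false, false_and]
          · simp [hi]
        rw [this]; omega
    · intro a ha
      have h := ((hmem a).mp ha).1
      funext i
      by_cases hi : i ∈ U
      · obtain ⟨l, hl⟩ := (hmemU i).mp hi
        simp only [if_pos hi]
        rw [h l i hl, Bool.eq_iff_iff, decide_eq_true_iff]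
        constructor
        · rintro ⟨l', h, h'⟩
          rwa [huniq l l' i hl h]
        · intro h
          exact ⟨l, hl, h⟩
      · simp [hi]
    · intro s hs
      rw [Finset.mem_powersetCard] at hs
      ext i
      have := @hs.1 i
      simp only [Finset.mem_compl, Finset.mem_filter] at this ⊢
      by_cases hi : i ∈ U
      · have h0 : i ∉ s := fun h => this h hi
        simp only [hi, h0, not_true_eq_false, false_and]
      · simp [hi]
  · rw [Nat.cast_eq_zero, Finset.card_eq_zero, Finset.eq_empty_iff_forall_notMem]
    intro a ha
    have h := ((hmem a).mp ha).2
    have h2 := Finset.card_filter_le Uᶜ (fun i => a i = true)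
    rw [hFcard] at h2
    exact hcond ⟨by omega, by omega⟩
end
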